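/- arXiv:2204.05489 — 6 statements merged into one kernel-verified Lean document; each statement's English description precedes it below -/
import Mathlib

section
/- Let G be a finite simple graph containing the odd cycle C_{2n+1} = (x_1,…,x_{2n+1}) (n ≥ 1) as an induced subgraph, and suppose some vertex of C_{2n+1} is incident to an edge of E(G)∖E(C_{2n+1}). Then the Type-II edge cover number satisfies γ″(C_{2n+1}) = n+1, and every Type-II minimum edge cover for C_{2n+1} in G consists of the n edges of a maximum matching of C_{2n+1} together with one edge of E(G)∖E(C_{2n+1}) incident to the unique vertex of C_{2n+1} left unsaturated by that matching. -/
noncomputable section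

/-- The edge set of the cycle `C_{2n+1}` with vertices `x 0, x 1, …, x (2n)`. -/
def cycleEdges {V : Type} (n : ℕ) (x : ZMod (2 * n + 1) → V) : Set (Sym2 V) :=
  Set.range fun j => s(x j, x (j + 1))

/-- `G` contains the cycle `C_{2n+1}` on the vertices `x j` as an induced subgraph. -/
structure HasInducedOddCycle {V : Type} (G : SimpleGraph V) (n : ℕ)
    (x : ZMod (2 * n + 1) → V) : Prop where
  inj : Function.Injective x
  adj_iff : ∀ i j : ZMod (2 * n + 1), G.Adj (x i) (x j) ↔ (j = i + 1 ∨ i = j + 1)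

/-- `L` is an edge cover for the cycle `C_{2n+1}` (with vertices `x j`) in `G`:
every vertex of the cycle is incident to some edge of `L`. -/
def IsEdgeCoverFor {V : Type} (G : SimpleGraph V) (n : ℕ) (x : ZMod (2 * n + 1) → V)
    (L : Finset (Sym2 V)) : Prop :=
  (↑L : Set (Sym2 V)) ⊆ G.edgeSet ∧ ∀ j : ZMod (2 * n + 1), ∃ e ∈ L, x j ∈ e

/-- A Type-I edge cover: all its edges are edges of the cycle. -/
def IsTypeICover {V : Type} (G : SimpleGraph V) (n : ℕ) (x : ZMod (2 * n + 1) → V)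
    (L : Finset (Sym2 V)) : Prop :=
  IsEdgeCoverFor G n x L ∧ (↑L : Set (Sym2 V)) ⊆ cycleEdges n x

/-- A Type-I minimum edge cover: a Type-I edge cover of smallest possible size. -/
def IsTypeIMinCover {V : Type} (G : SimpleGraph V) (n : ℕ) (x : ZMod (2 * n + 1) → V)
    (L : Finset (Sym2 V)) : Prop :=
  IsTypeICover G n x L ∧ ∀ L' : Finset (Sym2 V), IsTypeICover G n x L' → L.card ≤ L'.card

/-- A finite set of edges is a matching if its edges are pairwise disjoint. -/
def IsMatchingSet {V : Type} (M : Finset (Sym2 V)) : Prop :=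
  ∀ e ∈ M, ∀ f ∈ M, e ≠ f → ∀ v : V, ¬(v ∈ e ∧ v ∈ f)

/-- `v` is saturated by the matching `M`. -/
def Saturates {V : Type} (M : Finset (Sym2 V)) (v : V) : Prop :=
  ∃ e ∈ M, v ∈ e

/-- A Type-II edge cover: it contains at least one edge of `E(G) ∖ E(C_{2n+1})`. -/
def IsTypeIICover {V : Type} (G : SimpleGraph V) (n : ℕ) (x : ZMod (2 * n + 1) → V)
    (L : Finset (Sym2 V)) : Prop :=
  IsEdgeCoverFor G n x L ∧ ∃ e ∈ L, e ∉ cycleEdges n x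

/-- A Type-II minimum edge cover: a Type-II edge cover of smallest possible size. -/
def IsTypeIIMinCover {V : Type} (G : SimpleGraph V) (n : ℕ) (x : ZMod (2 * n + 1) → V)
    (L : Finset (Sym2 V)) : Prop :=
  IsTypeIICover G n x L ∧ ∀ L' : Finset (Sym2 V), IsTypeIICover G n x L' → L.card ≤ L'.card

open Classical in
/-- indices of cycle vertices incident to `e` -/
def touch {V : Type} (n : ℕ) (x : ZMod (2 * n + 1) → V) (e : Sym2 V) : Finset (ZMod (2 * n + 1)) :=
  Finset.univ.filter fun j => x j ∈ e

theorem mem_touch {V : Type} (n : ℕ) (x : ZMod (2 * n + 1) → V) (e : Sym2 V)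
    (j : ZMod (2 * n + 1)) : j ∈ touch n x e ↔ x j ∈ e := by
  simp [touch]

theorem touch_card_le_two {V : Type} (n : ℕ) (x : ZMod (2 * n + 1) → V)
    (hx : Function.Injective x) (e : Sym2 V) : (touch n x e).card ≤ 2 := by
  classical
  induction e using Sym2.ind with
  | _ a b =>
    rw [← Finset.card_image_of_injective _ hx]
    refine (Finset.card_le_card (t := {a, b}) ?_).trans Finset.card_le_two
    intro v hv
    obtain ⟨j, hj, rfl⟩ := Finset.mem_image.1 hv
    rw [mem_touch] at hj
    simpa using hj

theorem touch_card_le_one {V : Type} (G : SimpleGraph V) (n : ℕ) (x : ZMod (2 * n + 1) → V)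
    (hx : HasInducedOddCycle G n x) (e : Sym2 V) (he : e ∈ G.edgeSet) (hc : e ∉ cycleEdges n x) :
    (touch n x e).card ≤ 1 := by
  rw [Finset.card_le_one]
  intro i hi j hj
  rw [mem_touch] at hi hj
  by_contra hij
  have h := (Sym2.mem_and_mem_iff (fun h => hij (hx.inj h))).1 ⟨hi, hj⟩
  subst h
  rw [SimpleGraph.mem_edgeSet, hx.adj_iff] at he
  apply hc
  rcases he with rfl | rfl
  · exact ⟨i, rfl⟩
  · exact ⟨j, Sym2.eq_swap⟩

theorem biUnion_touch_card {V : Type} (n : ℕ) (x : ZMod (2 * n + 1) → V)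
    (hx : Function.Injective x) (M : Finset (Sym2 V)) :
    (M.biUnion (touch n x)).card ≤ 2 * M.card := by
  rw [mul_comm _ M.card]
  exact Finset.card_biUnion_le_card_mul _ _ _ fun e _ => touch_card_le_two n x hx e

theorem cover_lower {V : Type} [DecidableEq V] (G : SimpleGraph V) (n : ℕ)
    (x : ZMod (2 * n + 1) → V)
    (hx : HasInducedOddCycle G n x) (L : Finset (Sym2 V)) (hL : IsEdgeCoverFor G n x L)
    (e : Sym2 V) (he : e ∈ L) :
    2 * n + 1 ≤ (touch n x e).card + ((L.erase e).biUnion (touch n x)).card := by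
  have h : (Finset.univ : Finset (ZMod (2 * n + 1))) ⊆
      touch n x e ∪ (L.erase e).biUnion (touch n x) := by
    intro j _
    obtain ⟨f, hf, hj⟩ := hL.2 j
    rw [Finset.mem_union, Finset.mem_biUnion]
    by_cases hfe : f = e
    · left; rw [mem_touch, ← hfe]; exact hj
    · right; exact ⟨f, Finset.mem_erase.2 ⟨hfe, hf⟩, (mem_touch n x f j).2 hj⟩
  have h2 := (Finset.card_le_card h).trans (Finset.card_union_le _ _)
  rwa [Finset.card_univ, ZMod.card] at h2

theorem split_card {V : Type} [DecidableEq V] (n : ℕ) (x : ZMod (2 * n + 1) → V)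
    (M : Finset (Sym2 V)) (f : Sym2 V) (hf : f ∈ M) :
    M.biUnion (touch n x) = touch n x f ∪ (M.erase f).biUnion (touch n x) := by
  conv_lhs => rw [← Finset.insert_erase hf]
  rw [Finset.biUnion_insert]

theorem typeII_lower {V : Type} [DecidableEq V] (G : SimpleGraph V) (n : ℕ)
    (x : ZMod (2 * n + 1) → V)
    (hx : HasInducedOddCycle G n x) (L : Finset (Sym2 V)) (hL : IsTypeIICover G n x L) :
    n + 1 ≤ L.card := by
  obtain ⟨hc, e, he, hne⟩ := hL
  have h1 := cover_lower G n x hx L hc e he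
  have h2 := touch_card_le_one G n x hx e (hc.1 he) hne
  have h3 := biUnion_touch_card n x hx.inj (L.erase e)
  have h4 := Finset.card_erase_add_one he
  omega

theorem typeII_exists {V : Type} [DecidableEq V] (G : SimpleGraph V)
    (n : ℕ) (x : ZMod (2 * n + 1) → V) (hx : HasInducedOddCycle G n x)
    (hinc : ∃ (j : ZMod (2 * n + 1)) (e : Sym2 V),
      e ∈ G.edgeSet ∧ e ∉ cycleEdges n x ∧ x j ∈ e) :
    ∃ L : Finset (Sym2 V), IsTypeIICover G n x L ∧ L.card = n + 1 := by
  obtain ⟨j, e, he, hne, hj⟩ := hinc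
  let g : ℕ → Sym2 V := fun k => s(x (j + 1 + 2 * k), x (j + 1 + 2 * k + 1))
  let L : Finset (Sym2 V) := insert e ((Finset.range n).image g)
  have hL : IsTypeIICover G n x L := by
    refine ⟨⟨?_, ?_⟩, e, Finset.mem_insert_self _ _, hne⟩
    · intro f hf
      rcases Finset.mem_insert.1 hf with rfl | hf
      · exact he
      · obtain ⟨k, _, rfl⟩ := Finset.mem_image.1 hf
        exact (hx.adj_iff _ _).2 (Or.inl rfl)
    · intro i
      have hi : i = j + ((i - j).val : ZMod (2 * n + 1)) := by
        rw [ZMod.natCast_zmod_val]; ring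
      have hlt := ZMod.val_lt (i - j)
      generalize (i - j).val = d at hi hlt
      rcases Nat.eq_zero_or_pos d with rfl | hd
      · refine ⟨e, Finset.mem_insert_self _ _, ?_⟩
        simp at hi
        rw [hi]; exact hj
      · refine ⟨g ((d - 1) / 2), Finset.mem_insert_of_mem (Finset.mem_image.2
          ⟨_, Finset.mem_range.2 (by omega), rfl⟩), ?_⟩
        have hd2 : d = 1 + 2 * ((d - 1) / 2) ∨ d = 1 + 2 * ((d - 1) / 2) + 1 := by omega
        generalize (d - 1) / 2 = k at hd2
        rw [Sym2.mem_iff]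
        rcases hd2 with h | h
        · left; rw [hi, h]; push_cast; congr 1; ring
        · right; rw [hi, h]; push_cast; congr 1; ring
  refine ⟨L, hL, le_antisymm ?_ (typeII_lower G n x hx L hL)⟩
  refine (Finset.card_insert_le _ _).trans ?_
  have := Finset.card_image_le (s := Finset.range n) (f := g)
  rw [Finset.card_range] at this
  omega

/-- if some vertex of the induced odd cycle `C_{2n+1}` is incident to an edge of
`E(G) ∖ E(C_{2n+1})`, then the Type-II edge cover number is `n+1`, and every Type-II minimum
edge cover consists of the `n` edges of a maximum matching of the cycle together with one edge
of `E(G) ∖ E(C_{2n+1})` incident to the unique vertex of the cycle left unsaturated by that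
matching. -/
theorem typeII_min_cover_structure {V : Type} [Fintype V] [DecidableEq V] (G : SimpleGraph V)
    (n : ℕ) (hn : 1 ≤ n) (x : ZMod (2 * n + 1) → V) (hx : HasInducedOddCycle G n x)
    (hinc : ∃ (j : ZMod (2 * n + 1)) (e : Sym2 V),
      e ∈ G.edgeSet ∧ e ∉ cycleEdges n x ∧ x j ∈ e) :
    IsLeast {m : ℕ | ∃ L : Finset (Sym2 V), IsTypeIICover G n x L ∧ L.card = m} (n + 1) ∧
    ∀ L : Finset (Sym2 V), IsTypeIIMinCover G n x L →
      ∃ (M : Finset (Sym2 V)) (e : Sym2 V),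
        (↑M : Set (Sym2 V)) ⊆ cycleEdges n x ∧ IsMatchingSet M ∧ M.card = n ∧
        e ∈ G.edgeSet ∧ e ∉ cycleEdges n x ∧
        (∃ j : ZMod (2 * n + 1), ¬ Saturates M (x j) ∧ x j ∈ e) ∧
        L = M ∪ {e} := by
  have hex := typeII_exists G n x hx hinc
  refine ⟨⟨hex, ?_⟩, ?_⟩
  · rintro m ⟨L, hL, rfl⟩
    exact typeII_lower G n x hx L hL
  · rintro L ⟨hL, hmin⟩
    obtain ⟨L₀, hL₀, hc₀⟩ := hex
    have hcard : L.card = n + 1 :=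
      le_antisymm (hc₀ ▸ hmin L₀ hL₀) (typeII_lower G n x hx L hL)
    obtain ⟨hc, e, he, hne⟩ := hL
    have h1 := cover_lower G n x hx L hc e he
    have h2 := touch_card_le_one G n x hx e (hc.1 he) hne
    have h4 := Finset.card_erase_add_one he
    have hMc : (L.erase e).card = n := by omega
    have hcyc : (↑(L.erase e) : Set (Sym2 V)) ⊆ cycleEdges n x := by
      intro f hf
      by_contra hfc
      have hf' : f ∈ L.erase e := hf
      rw [split_card n x _ f hf'] at h1
      have h5 := Finset.card_union_le (touch n x f) (((L.erase e).erase f).biUnion (touch n x))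
      have h6 := biUnion_touch_card n x hx.inj ((L.erase e).erase f)
      have h7 := touch_card_le_one G n x hx f (hc.1 (Finset.mem_of_mem_erase hf')) hfc
      have h8 := Finset.card_erase_add_one hf'
      omega
    refine ⟨L.erase e, e, hcyc, ?_, hMc, hc.1 he, hne, ?_, ?_⟩
    · rintro f hf g hg hfg v ⟨hvf, hvg⟩
      obtain ⟨j, rfl⟩ : ∃ j, v = x j := by
        obtain ⟨i, rfl⟩ := hcyc hf
        rcases Sym2.mem_iff.1 hvf with h | h
        · exact ⟨_, h⟩
        · exact ⟨_, h⟩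
      have hg' : g ∈ (L.erase e).erase f := Finset.mem_erase.2 ⟨hfg.symm, hg⟩
      rw [split_card n x _ f hf, split_card n x _ g hg', ← Finset.union_assoc] at h1
      have h5 := Finset.card_union_le (touch n x f ∪ touch n x g)
        ((((L.erase e).erase f).erase g).biUnion (touch n x))
      have h6 := biUnion_touch_card n x hx.inj (((L.erase e).erase f).erase g)
      have h7 := Finset.card_union_add_card_inter (touch n x f) (touch n x g)
      have h8 := Finset.card_erase_add_one hf
      have h9 := Finset.card_erase_add_one hg'
      have h10 := touch_card_le_two n x hx.inj f
      have h11 := touch_card_le_two n x hx.inj g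
      have h12 : 0 < (touch n x f ∩ touch n x g).card :=
        Finset.card_pos.2 ⟨j, Finset.mem_inter.2
          ⟨(mem_touch n x f j).2 hvf, (mem_touch n x g j).2 hvg⟩⟩
      omega
    · have h6 := biUnion_touch_card n x hx.inj (L.erase e)
      have hpos : 0 < (touch n x e).card := by omega
      have hlt : ((L.erase e).biUnion (touch n x)).card <
          (Finset.univ : Finset (ZMod (2 * n + 1))).card := by
        rw [Finset.card_univ, ZMod.card]; omega
      obtain ⟨j, _, hj⟩ := Finset.exists_mem_notMem_of_card_lt_card hlt
      have hns : ¬ Saturates (L.erase e) (x j) := by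
        rintro ⟨f, hf, hxf⟩
        exact hj (Finset.mem_biUnion.2 ⟨f, hf, (mem_touch n x f j).2 hxf⟩)
      refine ⟨j, hns, ?_⟩
      obtain ⟨f, hf, hxf⟩ := hc.2 j
      by_cases hfe : f = e
      · rwa [← hfe]
      · exact absurd ⟨f, Finset.mem_erase.2 ⟨hfe, hf⟩, hxf⟩ hns
    · rw [Finset.union_comm, ← Finset.insert_eq, Finset.insert_erase he]

end
end

section
/- Let G be a finite simple graph containing the odd cycle C_{2n+1} = (x_1,…,x_{2n+1}) (n ≥ 1) as an induced subgraph, with l = |E(G)| − (2n+1). For each size j, let d′_j be the number of subsets of E(G) of size j that contain some Type-I minimum edge cover for C_{2n+1} in G. Then d′_{n+1+k} = (2n+1)·C(n−1+l, k) for 0 ≤ k ≤ n−1; d′_{2n+1+k} = (2n+1)·C(n−1+l, n+k) + C(l, k) for 0 ≤ k ≤ l−1; and d′_{2n+1+l} = 1. (Here C(a,b) denotes the binomial coefficient, with C(a,b) = 0 when b < 0 or b > a.) -/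
noncomputable section

open Classical in
theorem aux_count {α : Type} (E A B : Finset α) (hA : A ⊆ E) (hB : B ⊆ E)
    (hAB : Disjoint A B) (j : ℕ) :
    ((E.powersetCard (A.card + j)).filter (fun L => A ⊆ L ∧ Disjoint B L)).card
      = (E.card - A.card - B.card).choose j := by
  have h1 : (E \ (A ∪ B)).card = E.card - A.card - B.card := by
    rw [Finset.card_sdiff_of_subset (Finset.union_subset hA hB), Finset.card_union_of_disjoint hAB]
    omega
  rw [← h1, ← Finset.card_powersetCard]
  apply Finset.card_bij' (fun L _ => L \ A) (fun M _ => A ∪ M)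
  · intro L hL
    simp only [Finset.mem_filter, Finset.mem_powersetCard] at hL ⊢
    obtain ⟨⟨h2, h3⟩, h4, h5⟩ := hL
    refine ⟨?_, ?_⟩
    · intro y hy
      have := Finset.disjoint_right.1 h5
      grind
    · rw [Finset.card_sdiff_of_subset h4]; omega
  · intro M hM
    simp only [Finset.mem_filter, Finset.mem_powersetCard] at hM ⊢
    obtain ⟨h2, h3⟩ := hM
    have h4 : Disjoint A M := by
      rw [Finset.disjoint_left]; grind
    refine ⟨⟨?_, ?_⟩, ?_, ?_⟩
    · grind
    · rw [Finset.card_union_of_disjoint h4, h3]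
    · grind
    · rw [Finset.disjoint_left] at hAB ⊢; grind
  · intro L hL
    simp only [Finset.mem_filter, Finset.mem_powersetCard] at hL
    exact Finset.union_sdiff_of_subset hL.2.1
  · intro M hM
    simp only [Finset.mem_powersetCard] at hM
    ext y
    have := hM.1
    grind

theorem aux_natCast_inj (n : ℕ) {s t : ℕ} (hs : s < 2 * n + 1) (ht : t < 2 * n + 1)
    (h : (s : ZMod (2 * n + 1)) = t) : s = t := by
  have := congrArg ZMod.val h
  rwa [ZMod.val_cast_of_lt hs, ZMod.val_cast_of_lt ht] at this

theorem aux_two_n (n : ℕ) : (2 * n + 1 : ZMod (2 * n + 1)) = 0 := by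
  have := ZMod.natCast_self (2 * n + 1)
  push_cast at this
  exact this

theorem aux_exists_add (n : ℕ) (a b : ZMod (2 * n + 1)) :
    ∃ s : ℕ, s < 2 * n + 1 ∧ b = a + s := by
  refine ⟨(b - a).val, ZMod.val_lt _, ?_⟩
  rw [ZMod.natCast_zmod_val]; ring

/-- Combinatorial count of the sets that contain a long arc. -/
theorem aux_arcs {α : Type} (n l : ℕ) (hn : 1 ≤ n) (E : Finset α) (f : ZMod (2 * n + 1) → α)
    (hf : Function.Injective f) (hfE : ∀ i, f i ∈ E) (hE : E.card = 2 * n + 1 + l) (k : ℕ)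
    (D : Finset (Finset α))
    (hD : ∀ L, L ∈ D ↔ L ⊆ E ∧ L.card = n + 1 + k ∧
      ∃ a : ZMod (2 * n + 1), ∀ t : ℕ, t ≤ n → f (a + t) ∈ L) :
    D.card = (2 * n + 1) * (n - 1 + l).choose k + if n ≤ k then l.choose (k - n) else 0 := by
  classical
  let A : ZMod (2 * n + 1) → Finset α := fun a => (Finset.range (n + 1)).image fun t : ℕ => f (a + t)
  let P : ZMod (2 * n + 1) → Finset (Finset α) := fun a =>
    (E.powersetCard ((A a).card + k)).filter (fun L => A a ⊆ L ∧ Disjoint {f (a - 1)} L)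
  let F : Finset (Finset α) := (E.powersetCard (n + 1 + k)).filter
    (fun L => Finset.univ.image f ⊆ L ∧ Disjoint ∅ L)
  have hAc : ∀ a, (A a).card = n + 1 := by
    intro a
    rw [Finset.card_image_of_injOn, Finset.card_range]
    intro s hs t ht h
    simp only [Finset.coe_range, Set.mem_Iio] at hs ht
    exact aux_natCast_inj n (by omega) (by omega) (add_left_cancel (hf h))
  have hAE : ∀ a, A a ⊆ E := by
    intro a y hy
    simp only [A, Finset.mem_image] at hy
    obtain ⟨t, _, rfl⟩ := hy
    exact hfE _
  have hA' : ∀ a L, A a ⊆ L ↔ ∀ t : ℕ, t ≤ n → f (a + t) ∈ L := by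
    intro a L
    simp only [A, Finset.image_subset_iff, Finset.mem_range, Nat.lt_succ_iff]
  have hmP : ∀ a L, L ∈ P a ↔ L ⊆ E ∧ L.card = n + 1 + k ∧
      (∀ t : ℕ, t ≤ n → f (a + t) ∈ L) ∧ f (a - 1) ∉ L := by
    intro a L
    simp only [P, Finset.mem_filter, Finset.mem_powersetCard, hA', hAc,
      Finset.disjoint_singleton_left]
    tauto
  have hmF : ∀ L, L ∈ F ↔ L ⊆ E ∧ L.card = n + 1 + k ∧ ∀ i, f i ∈ L := by
    intro L
    simp only [F, Finset.mem_filter, Finset.mem_powersetCard, Finset.image_subset_iff,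
      Finset.mem_univ, forall_const, Finset.disjoint_empty_left, and_true, and_assoc]
  have h2n := aux_two_n n
  have hPc : ∀ a, (P a).card = (n - 1 + l).choose k := by
    intro a
    have := aux_count E (A a) {f (a - 1)} (hAE a) (by simpa using hfE _) (by
      rw [Finset.disjoint_singleton_right]
      simp only [A, Finset.mem_image, Finset.mem_range, not_exists, not_and]
      intro t ht h
      have h1 := hf h
      have h2 : ((t + 1 : ℕ) : ZMod (2 * n + 1)) = (0 : ℕ) := by
        push_cast; linear_combination h1
      have := aux_natCast_inj n (by omega) (by omega) h2
      omega) k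
    rw [this, hAc, hE, Finset.card_singleton]
    congr 1; omega
  have hFc : F.card = if n ≤ k then l.choose (k - n) else 0 := by
    have hc : (Finset.univ.image f).card = 2 * n + 1 := by
      rw [Finset.card_image_of_injective _ hf, Finset.card_univ, ZMod.card]
    split_ifs with h
    · have := aux_count E (Finset.univ.image f) ∅ (by
        intro y hy
        simp only [Finset.mem_image] at hy
        obtain ⟨t, _, rfl⟩ := hy
        exact hfE _) (by simp) (by simp) (k - n)
      rw [hc, hE, show 2 * n + 1 + (k - n) = n + 1 + k by omega] at this
      rw [show F.card = _ from this]
      congr 1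
      simp
    · rw [Finset.card_eq_zero, Finset.eq_empty_iff_forall_notMem]
      intro L hL
      rw [hmF] at hL
      have : Finset.univ.image f ⊆ L := by
        intro y hy
        simp only [Finset.mem_image] at hy
        obtain ⟨t, _, rfl⟩ := hy
        exact hL.2.2 _
      have := Finset.card_le_card this
      omega
  have hU : D = Finset.univ.biUnion P ∪ F := by
    ext L
    simp only [Finset.mem_union, Finset.mem_biUnion, Finset.mem_univ, true_and, hmP, hmF, hD]
    constructor
    · rintro ⟨h1, h2, a, ha⟩
      by_cases hfull : ∀ i, f i ∈ L
      · exact Or.inr ⟨h1, h2, hfull⟩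
      · left
        push Not at hfull
        obtain ⟨i, hi⟩ := hfull
        obtain ⟨s, _, hs⟩ := aux_exists_add n i a
        have hex : ∃ t : ℕ, f (a - t) ∉ L := ⟨s, by rwa [hs, add_sub_cancel_right]⟩
        let m := Nat.find hex
        have hm : f (a - m) ∉ L := Nat.find_spec hex
        have hmin : ∀ t, t < m → f (a - t) ∈ L := fun t ht => not_not.1 (Nat.find_min hex ht)
        have hm1 : 1 ≤ m := by
          by_contra h0
          have h0 : m = 0 := by omega
          rw [h0] at hm
          have := ha 0 (by omega)
          simp at hm this
          exact hm this
        refine ⟨a - m + 1, h1, h2, ?_, by simpa using hm⟩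
        intro t ht
        by_cases htm : t + 1 ≤ m
        · have := hmin (m - 1 - t) (by omega)
          convert this using 2
          rw [Nat.cast_sub (by omega), Nat.cast_sub hm1]
          push_cast; ring
        · have := ha (t + 1 - m) (by omega)
          convert this using 2
          rw [Nat.cast_sub (by omega)]
          push_cast; ring
    · rintro (⟨a, h1, h2, h3, _⟩ | ⟨h1, h2, h3⟩)
      · exact ⟨h1, h2, a, h3⟩
      · exact ⟨h1, h2, 0, fun t _ => h3 _⟩
  rw [hU, Finset.card_union_of_disjoint, hFc, Finset.card_biUnion, Finset.sum_congr rfl (fun a _ => hPc a)]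
  · simp [ZMod.card]
  · intro a _ b _ hab
    rw [Function.onFun, Finset.disjoint_left]
    intro L hLa hLb
    rw [hmP] at hLa hLb
    obtain ⟨-, -, ha, ha'⟩ := hLa
    obtain ⟨-, -, hb, hb'⟩ := hLb
    obtain ⟨s, hs, rfl⟩ := aux_exists_add n a b
    have hs0 : s ≠ 0 := by rintro rfl; simp at hab
    by_cases h : s ≤ n + 1
    · apply hb'
      have := ha (s - 1) (by omega)
      convert this using 2
      rw [Nat.cast_sub (by omega)]
      push_cast; ring
    · apply ha'
      have := hb (2 * n + 1 - s - 1) (by omega)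
      convert this using 2
      rw [Nat.cast_sub (by omega), Nat.cast_sub (by omega)]
      push_cast
      linear_combination - h2n
  · rw [Finset.disjoint_left]
    intro L hL hLF
    simp only [Finset.mem_biUnion, hmP, Finset.mem_univ, true_and] at hL
    obtain ⟨a, -, -, -, h⟩ := hL
    exact h (((hmF L).1 hLF).2.2 _)

/-- Index form of the size bound and structure of minimum covers. -/
theorem aux_cover_card (n : ℕ) (S : Finset (ZMod (2 * n + 1)))
    (hS : ∀ j, j ∈ S ∨ j - 1 ∈ S) : n + 1 ≤ S.card := by
  classical
  have h : (Finset.univ : Finset (ZMod (2 * n + 1))) ⊆ S ∪ S.image (· + 1) := by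
    intro j _
    rcases hS j with h | h
    · simp [h]
    · rw [Finset.mem_union, Finset.mem_image]; right; exact ⟨_, h, by ring⟩
  have h1 := Finset.card_le_card h
  have h2 := Finset.card_union_le S (S.image (· + 1))
  have h3 : (S.image (· + 1)).card ≤ S.card := Finset.card_image_le
  rw [Finset.card_univ, ZMod.card] at h1
  omega

theorem aux_cover_arc (n : ℕ) (S : Finset (ZMod (2 * n + 1)))
    (hS : ∀ j, j ∈ S ∨ j - 1 ∈ S) (hc : S.card = n + 1) :
    ∃ j : ZMod (2 * n + 1), ∀ t : ℕ, t ≤ n → j + 2 * t ∈ S := by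
  classical
  have h : S ∪ S.image (· + 1) = (Finset.univ : Finset (ZMod (2 * n + 1))) := by
    rw [Finset.eq_univ_iff_forall]
    intro j
    rcases hS j with h | h
    · simp [h]
    · rw [Finset.mem_union, Finset.mem_image]; right; exact ⟨_, h, by ring⟩
  have h3 : (S.image (· + 1)).card = S.card :=
    Finset.card_image_of_injective _ (add_left_injective 1)
  have h4 := Finset.card_union_add_card_inter S (S.image (· + 1))
  rw [h, Finset.card_univ, ZMod.card, h3, hc] at h4
  have h5 : (S ∩ S.image (· + 1)).card = 1 := by omega
  obtain ⟨j, hj⟩ := Finset.card_eq_one.1 h5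
  have hu : ∀ i, i ∈ S → i - 1 ∈ S → i = j := by
    intro i h1 h2
    have : i ∈ S ∩ S.image (· + 1) := by
      rw [Finset.mem_inter, Finset.mem_image]; exact ⟨h1, _, h2, by ring⟩
    rw [hj] at this
    simpa using this
  have hjS : j ∈ S := by
    have : j ∈ S ∩ S.image (· + 1) := by rw [hj]; simp
    exact (Finset.mem_inter.1 this).1
  refine ⟨j, fun t => ?_⟩
  induction t with
  | zero => intro _; simpa using hjS
  | succ t ih =>
    intro ht
    have h1 := ih (by omega)
    have h2 : j + 2 * t + 1 ∉ S := by
      intro h2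
      have h6 := hu _ h2 (by simpa using h1)
      have h7 : ((2 * t + 1 : ℕ) : ZMod (2 * n + 1)) = (0 : ℕ) := by
        push_cast; linear_combination h6
      have := aux_natCast_inj n (by omega) (by omega) h7
      omega
    rcases hS (j + 2 * (t + 1 : ℕ)) with h8 | h8
    · exact h8
    · exfalso; apply h2; convert h8 using 1; push_cast; ring

section
variable {V : Type} {G : SimpleGraph V} {n : ℕ} {x : ZMod (2 * n + 1) → V}

theorem aux_e_inj (hn : 1 ≤ n) (hx : Function.Injective x) :
    Function.Injective (fun j => s(x j, x (j + 1))) := by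
  intro i j h
  simp only [Sym2.eq_iff] at h
  rcases h with ⟨h, _⟩ | ⟨h1, h2⟩
  · exact hx h
  · have h1 := hx h1
    have h2 := hx h2
    have h3 : ((2 : ℕ) : ZMod (2 * n + 1)) = (0 : ℕ) := by
      push_cast; linear_combination h2 - h1
    have := aux_natCast_inj n (by omega) (by omega) h3
    omega

theorem aux_mem_e (hx : Function.Injective x) (i j : ZMod (2 * n + 1)) :
    x j ∈ s(x i, x (i + 1)) ↔ i = j ∨ i = j - 1 := by
  rw [Sym2.mem_iff, hx.eq_iff, hx.eq_iff]
  constructor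
  · rintro (h | h)
    · exact Or.inl h.symm
    · right; rw [h]; ring
  · rintro (h | h)
    · exact Or.inl h.symm
    · right; rw [h]; ring

theorem aux_cover_iff (hn : 1 ≤ n) (hx : HasInducedOddCycle G n x) (L : Finset (Sym2 V)) :
    IsTypeICover G n x L ↔ ∃ S : Finset (ZMod (2 * n + 1)), (∀ j, j ∈ S ∨ j - 1 ∈ S) ∧
      L = S.map ⟨_, aux_e_inj hn hx.inj⟩ := by
  classical
  constructor
  · rintro ⟨⟨h1, h2⟩, h3⟩
    refine ⟨Finset.univ.filter fun j => s(x j, x (j + 1)) ∈ L, ?_, ?_⟩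
    · intro j
      obtain ⟨e, he, hj⟩ := h2 j
      obtain ⟨i, rfl⟩ := h3 he
      simp only [Finset.mem_filter, Finset.mem_univ, true_and]
      rcases (aux_mem_e hx.inj i j).1 hj with rfl | rfl
      · exact Or.inl he
      · exact Or.inr he
    · ext e
      simp only [Finset.mem_map, Finset.mem_filter, Finset.mem_univ, true_and,
        Function.Embedding.coeFn_mk]
      constructor
      · intro he
        obtain ⟨i, rfl⟩ := h3 he
        exact ⟨i, he, rfl⟩
      · rintro ⟨i, hi, rfl⟩; exact hi
  · rintro ⟨S, hS, rfl⟩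
    refine ⟨⟨?_, ?_⟩, ?_⟩
    · intro e he
      simp only [Finset.coe_map, Function.Embedding.coeFn_mk, Set.mem_image] at he
      obtain ⟨i, _, rfl⟩ := he
      rw [SimpleGraph.mem_edgeSet, hx.adj_iff]
      exact Or.inl rfl
    · intro j
      rcases hS j with h | h
      · exact ⟨_, Finset.mem_map_of_mem _ h, (aux_mem_e hx.inj _ j).2 (Or.inl rfl)⟩
      · exact ⟨_, Finset.mem_map_of_mem _ h, (aux_mem_e hx.inj _ j).2 (Or.inr rfl)⟩
    · intro e he
      simp only [Finset.coe_map, Function.Embedding.coeFn_mk, Set.mem_image] at he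
      obtain ⟨i, _, rfl⟩ := he
      exact ⟨i, rfl⟩

theorem aux_arc_cover (n : ℕ) (j : ZMod (2 * n + 1)) :
    ∃ S : Finset (ZMod (2 * n + 1)), (∀ j, j ∈ S ∨ j - 1 ∈ S) ∧ S.card = n + 1 ∧
      ∀ i ∈ S, ∃ t : ℕ, t ≤ n ∧ i = j + 2 * t := by
  classical
  let S := (Finset.range (n + 1)).image fun t : ℕ => j + 2 * (t : ZMod (2 * n + 1))
  have hS : ∀ j, j ∈ S ∨ j - 1 ∈ S := by
    intro i
    obtain ⟨s, hs, rfl⟩ := aux_exists_add n j i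
    simp only [S, Finset.mem_image, Finset.mem_range]
    rcases Nat.even_or_odd' s with ⟨c, rfl | rfl⟩
    · exact Or.inl ⟨c, by omega, by push_cast; ring⟩
    · exact Or.inr ⟨c, by omega, by push_cast; ring⟩
  refine ⟨S, hS, le_antisymm ?_ (aux_cover_card n S hS), ?_⟩
  · exact Finset.card_image_le.trans (by simp)
  · intro i hi
    simp only [S, Finset.mem_image, Finset.mem_range] at hi
    obtain ⟨t, ht, rfl⟩ := hi
    exact ⟨t, by omega, rfl⟩

theorem aux_min_iff (hn : 1 ≤ n) (hx : HasInducedOddCycle G n x) (L : Finset (Sym2 V)) :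
    (∃ C : Finset (Sym2 V), IsTypeIMinCover G n x C ∧ C ⊆ L) ↔
      ∃ j : ZMod (2 * n + 1), ∀ t : ℕ, t ≤ n → s(x (j + 2 * t), x (j + 2 * t + 1)) ∈ L := by
  constructor
  · rintro ⟨C, ⟨hC, hmin⟩, hCL⟩
    obtain ⟨S, hS, rfl⟩ := (aux_cover_iff hn hx C).1 hC
    obtain ⟨S', hS', hc', -⟩ := aux_arc_cover n 0
    have := hmin _ ((aux_cover_iff hn hx _).2 ⟨S', hS', rfl⟩)
    rw [Finset.card_map, Finset.card_map, hc'] at this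
    obtain ⟨j, hj⟩ := aux_cover_arc n S hS (le_antisymm this (aux_cover_card n S hS))
    exact ⟨j, fun t ht => hCL (Finset.mem_map_of_mem ⟨_, aux_e_inj hn hx.inj⟩ (hj t ht))⟩
  · rintro ⟨j, hj⟩
    obtain ⟨S, hS, hc, hs⟩ := aux_arc_cover n j
    refine ⟨S.map ⟨_, aux_e_inj hn hx.inj⟩, ⟨(aux_cover_iff hn hx _).2 ⟨S, hS, rfl⟩, ?_⟩, ?_⟩
    · intro L' hL'
      obtain ⟨S', hS', rfl⟩ := (aux_cover_iff hn hx L').1 hL'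
      rw [Finset.card_map, Finset.card_map, hc]
      exact aux_cover_card n S' hS'
    · intro e he
      simp only [Finset.mem_map, Function.Embedding.coeFn_mk] at he
      obtain ⟨i, hi, rfl⟩ := he
      obtain ⟨t, ht, rfl⟩ := hs i hi
      exact hj t ht

end

/-- counting edge subsets of `G` that contain a Type-I minimum edge cover of the
induced odd cycle `C_{2n+1}`. -/
theorem count_typeI_supersets {V : Type} [Fintype V] [DecidableEq V] (G : SimpleGraph V)
    (n : ℕ) (hn : 1 ≤ n) (x : ZMod (2 * n + 1) → V) (hx : HasInducedOddCycle G n x)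
    (l : ℕ) (hl : l = G.edgeSet.ncard - (2 * n + 1))
    (d' : ℕ → ℕ)
    (hd' : ∀ j : ℕ, d' j =
      {L : Finset (Sym2 V) | (↑L : Set (Sym2 V)) ⊆ G.edgeSet ∧ L.card = j ∧
        ∃ C : Finset (Sym2 V), IsTypeIMinCover G n x C ∧ C ⊆ L}.ncard) :
    (∀ k : ℕ, k ≤ n - 1 → d' (n + 1 + k) = (2 * n + 1) * Nat.choose (n - 1 + l) k) ∧
    (∀ k : ℕ, k < l →
      d' (2 * n + 1 + k) = (2 * n + 1) * Nat.choose (n - 1 + l) (n + k) + Nat.choose l k) ∧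
    d' (2 * n + 1 + l) = 1 := by
  classical
  let f : ZMod (2 * n + 1) → Sym2 V := fun i => s(x (2 * i), x (2 * i + 1))
  have h2n := aux_two_n n
  have hf : Function.Injective f := by
    intro a b h
    have h1 : 2 * a = 2 * b := aux_e_inj hn hx.inj h
    linear_combination (-n : ZMod (2 * n + 1)) * h1 + (a - b) * h2n
  have hfE : ∀ i, f i ∈ G.edgeSet.toFinset := by
    intro i
    rw [Set.mem_toFinset, SimpleGraph.mem_edgeSet, hx.adj_iff]
    exact Or.inl rfl
  have hE : G.edgeSet.toFinset.card = 2 * n + 1 + l := by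
    have h1 : (Finset.univ.image f).card ≤ G.edgeSet.toFinset.card := by
      apply Finset.card_le_card
      intro y hy
      simp only [Finset.mem_image] at hy
      obtain ⟨t, _, rfl⟩ := hy
      exact hfE _
    rw [Finset.card_image_of_injective _ hf, Finset.card_univ, ZMod.card] at h1
    rw [Set.ncard_eq_toFinset_card'] at hl
    omega
  have key : ∀ k, d' (n + 1 + k) =
      (2 * n + 1) * (n - 1 + l).choose k + if n ≤ k then l.choose (k - n) else 0 := by
    intro k
    rw [hd', Set.ncard_eq_toFinset_card']
    apply aux_arcs n l hn G.edgeSet.toFinset f hf hfE hE k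
    intro L
    rw [Set.mem_toFinset, Set.mem_ofPred_eq, aux_min_iff hn hx]
    refine and_congr ?_ (and_congr Iff.rfl ?_)
    · rw [Set.subset_toFinset]
    · constructor
      · rintro ⟨j, hj⟩
        refine ⟨-n * j, fun t ht => ?_⟩
        have h3 : 2 * (-n * j + t) = j + 2 * t := by linear_combination (-j) * h2n
        simp only [f, h3]
        exact hj t ht
      · rintro ⟨a, ha⟩
        refine ⟨2 * a, fun t ht => ?_⟩
        have := ha t ht
        simp only [f, mul_add] at this
        exact this
  refine ⟨?_, ?_, ?_⟩
  · intro k hk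
    rw [key, if_neg (by omega), add_zero]
  · intro k hk
    rw [show 2 * n + 1 + k = n + 1 + (n + k) by ring, key, if_pos (by omega)]
    simp
  · rw [show 2 * n + 1 + l = n + 1 + (n + l) by ring, key, if_pos (by omega),
      Nat.choose_eq_zero_of_lt (by omega)]
    simp

end
end

section
/- Let G be a finite simple graph containing the odd cycle C_{2n+1} = (x_1,…,x_{2n+1}) (n ≥ 1) as an induced subgraph. Let G′ = G∖E(C_{2n+1}), l = |E(G′)|, let y_1,…,y_m be the vertices of C_{2n+1} incident to some edge of G′, let l_i be the number of edges of G′ incident to y_i, and set u_i = (n−1) + (l − l_i). For 1 ≤ k ≤ n−1+l, the number d″_{n+k} of subsets of E(G) of size n+k that contain some Type-II minimum edge cover for C_{2n+1} in G but contain no Type-I minimum edge cover for C_{2n+1} in G equals Σ_{i=1}^{m} Σ_{j=1}^{l_i} C(l_i, j)·C(u_i, k−j), where C(a,b) = 0 when b < 0 or b > a. -/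
noncomputable section

/-! ### Index combinatorics on `ZMod (2n+1)` -/

lemma zval_sub_one (n : ℕ) (d : ZMod (2 * n + 1)) (hd : d ≠ 0) : (d - 1).val + 1 = d.val := by
  obtain ⟨k, hk⟩ : ∃ k, d.val = k + 1 :=
    Nat.exists_eq_succ_of_ne_zero (fun h => hd ((ZMod.val_eq_zero d).1 h))
  have h1 : d = ((k + 1 : ℕ) : ZMod (2 * n + 1)) := by rw [← hk]; simp
  have h2 : d - 1 = (k : ZMod (2 * n + 1)) := by rw [h1]; push_cast; ring
  have h3 := ZMod.val_lt d
  rw [h2, ZMod.val_cast_of_lt (by omega), hk]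

def oddIdx (n : ℕ) (i : ZMod (2 * n + 1)) : Finset (ZMod (2 * n + 1)) :=
  Finset.univ.filter (fun j => Odd (j - i).val)

lemma mem_oddIdx {n : ℕ} {i j : ZMod (2 * n + 1)} : j ∈ oddIdx n i ↔ Odd (j - i).val := by
  simp [oddIdx]

lemma self_not_mem_oddIdx (n : ℕ) (i : ZMod (2 * n + 1)) : i ∉ oddIdx n i := by
  simp [mem_oddIdx]

lemma pred_not_mem_oddIdx (n : ℕ) (i : ZMod (2 * n + 1)) : i - 1 ∉ oddIdx n i := by
  rw [mem_oddIdx]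
  have : i - 1 - i = (-1 : ZMod (2 * n).succ) := by ring
  have h2 : (i - 1 - i).val = 2 * n := by
    rw [this]; exact ZMod.val_neg_one (2 * n)
  rw [h2]; simp

lemma oddIdx_cover {n : ℕ} {i j : ZMod (2 * n + 1)} (h : j ≠ i) :
    (j ∈ oddIdx n i ↔ j - 1 ∉ oddIdx n i) := by
  rw [mem_oddIdx, mem_oddIdx]
  have := zval_sub_one n (j - i) (sub_ne_zero.2 h)
  rw [show j - 1 - i = j - i - 1 by ring, ← this]
  rw [Nat.odd_add_one]

def cnt {n : ℕ} (S : Finset (ZMod (2 * n + 1))) (j : ZMod (2 * n + 1)) : ℕ :=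
  (if j ∈ S then 1 else 0) + (if j - 1 ∈ S then 1 else 0)

lemma sum_cnt {n : ℕ} (S : Finset (ZMod (2 * n + 1))) : ∑ j, cnt S j = 2 * S.card := by
  unfold cnt
  rw [Finset.sum_add_distrib]
  have h := (Equiv.subRight (1 : ZMod (2 * n + 1))).sum_comp (fun j => if j ∈ S then 1 else 0)
  simp only [Equiv.subRight_apply] at h
  rw [h]
  simp; omega

lemma card_erase_univ (n : ℕ) (i : ZMod (2 * n + 1)) :
    (Finset.univ.erase i).card = 2 * n := by
  rw [Finset.card_erase_of_mem (Finset.mem_univ _), Finset.card_univ, ZMod.card]; omega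

lemma card_oddIdx (n : ℕ) (i : ZMod (2 * n + 1)) : (oddIdx n i).card = n := by
  have h := sum_cnt (oddIdx n i)
  rw [← Finset.add_sum_erase _ _ (Finset.mem_univ i)] at h
  have h0 : cnt (oddIdx n i) i = 0 := by
    simp [cnt, self_not_mem_oddIdx, pred_not_mem_oddIdx]
  have h1 : ∀ j ∈ Finset.univ.erase i, cnt (oddIdx n i) j = 1 := by
    intro j hj
    have := oddIdx_cover (Finset.ne_of_mem_erase hj)
    unfold cnt
    by_cases hh : j - 1 ∈ oddIdx n i <;> simp_all
  rw [h0, Finset.sum_congr rfl h1, Finset.sum_const, card_erase_univ] at h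
  simp at h; omega

lemma eq_oddIdx {n : ℕ} {i : ZMod (2 * n + 1)} {S : Finset (ZMod (2 * n + 1))}
    (hS : S.card ≤ n) (hc : ∀ j, j ≠ i → j ∈ S ∨ j - 1 ∈ S) : S = oddIdx n i := by
  have h := sum_cnt S
  rw [← Finset.add_sum_erase _ _ (Finset.mem_univ i)] at h
  have h1 : ∀ j ∈ Finset.univ.erase i, 1 ≤ cnt S j := by
    intro j hj
    have := hc j (Finset.ne_of_mem_erase hj)
    unfold cnt
    rcases this with h | h <;> simp [h]
  have h2 := Finset.sum_le_sum h1
  have hs : ∑ j ∈ Finset.univ.erase i, 1 = 2 * n := by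
    rw [Finset.sum_const, card_erase_univ]; simp
  have h0 : cnt S i = 0 := by omega
  have h3 : ∀ j ∈ Finset.univ.erase i, 1 = cnt S j :=
    (Finset.sum_eq_sum_iff_of_le h1).1 (by omega)
  have hi : i ∉ S := by
    intro hh; simp [cnt, hh] at h0
  have key : ∀ k : ℕ, k < 2 * n + 1 → (i + (k : ZMod (2 * n + 1)) ∈ S ↔ Odd k) := by
    intro k
    induction k with
    | zero => intro _; simp [hi]
    | succ k ih =>
      intro hk
      have ih := ih (by omega)
      have hne : i + ((k + 1 : ℕ) : ZMod (2 * n + 1)) ≠ i := by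
        intro hh
        have h5 : ((k + 1 : ℕ) : ZMod (2 * n + 1)) = 0 := by simpa using hh
        have := congrArg ZMod.val h5
        rw [ZMod.val_cast_of_lt hk] at this
        simp at this
      have h6 := h3 _ (Finset.mem_erase.2 ⟨hne, Finset.mem_univ _⟩)
      have h7 : i + ((k + 1 : ℕ) : ZMod (2 * n + 1)) - 1 = i + (k : ZMod (2 * n + 1)) := by
        push_cast; ring
      unfold cnt at h6
      rw [h7] at h6
      rw [Nat.odd_add_one, ← ih]
      split_ifs at h6 with p q q <;> first | omega | tauto
  ext j
  have := key (j - i).val (ZMod.val_lt _)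
  rw [mem_oddIdx, ← this]
  simp

/-! ### A generic counting lemma -/

lemma count_generic {α : Type} [DecidableEq α] (M A R : Finset α)
    (hMA : Disjoint M A) (hMR : Disjoint M R) (hAR : Disjoint A R) (k : ℕ) :
    (((M ∪ A ∪ R).powerset).filter
      (fun L => L.card = M.card + k ∧ M ⊆ L ∧ (L ∩ A).Nonempty)).card =
    ∑ j ∈ Finset.Icc 1 A.card,
      A.card.choose j * (if j ≤ k then R.card.choose (k - j) else 0) := by
  have dec : ∀ L, L ⊆ M ∪ A ∪ R → M ⊆ L → L = M ∪ (L ∩ A) ∪ (L ∩ R) := by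
    intro L h1 h2; ext e
    have := @h1 e; have := @h2 e
    simp only [Finset.mem_union, Finset.mem_inter] at *; tauto
  have cardf : ∀ X Y, X ⊆ A → Y ⊆ R → (M ∪ X ∪ Y).card = M.card + X.card + Y.card := by
    intro X Y hX hY
    rw [Finset.card_union_of_disjoint, Finset.card_union_of_disjoint]
    · exact hMA.mono_right hX
    · rw [Finset.disjoint_union_left]
      exact ⟨hMR.mono_right hY, hAR.mono hX hY⟩
  rw [Finset.card_eq_sum_card_fiberwise (f := fun L => (L ∩ A).card) (t := Finset.Icc 1 A.card)]
  · refine Finset.sum_congr rfl fun j hj => ?_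
    rw [Finset.mem_Icc] at hj
    split_ifs with hjk
    · rw [← Finset.card_powersetCard, ← Finset.card_powersetCard, ← Finset.card_product]
      refine Finset.card_bij' (fun L _ => (L ∩ A, L ∩ R)) (fun p _ => M ∪ p.1 ∪ p.2) ?_ ?_ ?_ ?_
      · intro L hL
        simp only [Finset.mem_filter, Finset.mem_powerset] at hL
        obtain ⟨⟨h1, h2, h3, h4⟩, h5⟩ := hL
        have h6 := cardf (L ∩ A) (L ∩ R) Finset.inter_subset_right Finset.inter_subset_right
        rw [← dec L h1 h3] at h6
        simp only [Finset.mem_product, Finset.mem_powersetCard]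
        refine ⟨⟨Finset.inter_subset_right, h5⟩, Finset.inter_subset_right, by omega⟩
      · rintro ⟨X, Y⟩ hp
        simp only [Finset.mem_product, Finset.mem_powersetCard] at hp
        obtain ⟨⟨h1, h2⟩, h3, h4⟩ := hp
        have h6 := cardf X Y h1 h3
        have h7 : (M ∪ X ∪ Y) ∩ A = X := by
          ext e
          have a1 := @h1 e; have a2 := @h3 e
          have a3 : e ∈ M → e ∉ A := fun h => Finset.disjoint_left.1 hMA h
          have a4 : e ∈ A → e ∉ R := fun h => Finset.disjoint_left.1 hAR h
          simp only [Finset.mem_union, Finset.mem_inter]; tauto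
        simp only [Finset.mem_filter, Finset.mem_powerset]
        rw [h7]
        refine ⟨⟨?_, by omega, ?_, ?_⟩, h2⟩
        · exact Finset.union_subset_union (Finset.union_subset_union subset_rfl h1) h3
        · intro e he; simp [he]
        · rw [← Finset.card_pos]; omega
      · intro L hL
        simp only [Finset.mem_filter, Finset.mem_powerset] at hL
        exact (dec L hL.1.1 hL.1.2.2.1).symm
      · rintro ⟨X, Y⟩ hp
        simp only [Finset.mem_product, Finset.mem_powersetCard] at hp
        obtain ⟨⟨h1, h2⟩, h3, h4⟩ := hp
        ext e
        all_goals
          have a1 := @h1 e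
          have a2 := @h3 e
          have a3 : e ∈ M → e ∉ A := fun h => Finset.disjoint_left.1 hMA h
          have a4 : e ∈ A → e ∉ R := fun h => Finset.disjoint_left.1 hAR h
          have a5 : e ∈ M → e ∉ R := fun h => Finset.disjoint_left.1 hMR h
          simp only [Finset.mem_union, Finset.mem_inter]
          tauto
    · rw [mul_zero, Finset.card_eq_zero, Finset.eq_empty_iff_forall_notMem]
      intro L hL
      simp only [Finset.mem_filter, Finset.mem_powerset] at hL
      obtain ⟨⟨h1, h2, h3, h4⟩, h5⟩ := hL
      have h6 := cardf (L ∩ A) (L ∩ R) Finset.inter_subset_right Finset.inter_subset_right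
      rw [← dec L h1 h3] at h6
      omega
  · intro L hL
    simp only [Finset.mem_coe, Finset.mem_filter] at hL
    simp only [Finset.coe_Icc, Set.mem_Icc]
    exact ⟨Finset.card_pos.2 hL.2.2.2, Finset.card_le_card Finset.inter_subset_right⟩

/-! ### Cycle edges -/

section graph

variable {V : Type} {G : SimpleGraph V} {n : ℕ} {x : ZMod (2 * n + 1) → V}

def cEdge (x : ZMod (2 * n + 1) → V) (j : ZMod (2 * n + 1)) : Sym2 V := s(x j, x (j + 1))

lemma mem_cEdge (hx : HasInducedOddCycle G n x) {v j : ZMod (2 * n + 1)} :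
    x v ∈ cEdge x j ↔ (j = v ∨ j = v - 1) := by
  unfold cEdge
  rw [Sym2.mem_iff, hx.inj.eq_iff, hx.inj.eq_iff, eq_sub_iff_add_eq, eq_comm, @eq_comm _ v (j + 1)]

lemma cEdge_inj (hn : 1 ≤ n) (hx : HasInducedOddCycle G n x) : Function.Injective (cEdge x) := by
  intro j k h
  unfold cEdge at h
  rw [Sym2.eq_iff, hx.inj.eq_iff, hx.inj.eq_iff, hx.inj.eq_iff, hx.inj.eq_iff] at h
  rcases h with h | ⟨h1, h2⟩
  · exact h.1
  · exfalso
    have h3 : ((2 : ℕ) : ZMod (2 * n + 1)) = 0 := by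
      rw [h1] at h2
      push_cast
      linear_combination h2
    have := congrArg ZMod.val h3
    rw [ZMod.val_cast_of_lt (by omega)] at this
    simp at this

lemma cEdge_mem_edgeSet (hx : HasInducedOddCycle G n x) (j : ZMod (2 * n + 1)) :
    cEdge x j ∈ G.edgeSet := by
  unfold cEdge
  rw [SimpleGraph.mem_edgeSet, hx.adj_iff]; left; rfl

lemma cEdge_mem_cycle (j : ZMod (2 * n + 1)) : cEdge x j ∈ cycleEdges n x := ⟨j, rfl⟩

lemma mem_cycle_iff {e : Sym2 V} : e ∈ cycleEdges n x ↔ ∃ j, cEdge x j = e := Iff.rfl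

lemma noncycle_unique (hx : HasInducedOddCycle G n x) {e : Sym2 V} (he : e ∈ G.edgeSet)
    (hc : e ∉ cycleEdges n x) {a b : ZMod (2 * n + 1)} (ha : x a ∈ e) (hb : x b ∈ e) : a = b := by
  by_contra hab
  have hne : x a ≠ x b := fun h => hab (hx.inj h)
  have h : e = s(x a, x b) := (Sym2.mem_and_mem_iff hne).1 ⟨ha, hb⟩
  rw [h, SimpleGraph.mem_edgeSet, hx.adj_iff] at he
  apply hc
  rcases he with rfl | rfl
  · exact ⟨a, h.symm⟩
  · exact ⟨b, by rw [h]; exact Sym2.eq_swap⟩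

lemma cover_card_ge [DecidableEq V] (hx : HasInducedOddCycle G n x) {L : Finset (Sym2 V)}
    (hL : IsEdgeCoverFor G n x L) : n + 1 ≤ L.card := by
  have h1 : Finset.univ.image x ⊆ L.biUnion Sym2.toFinset := by
    intro v hv
    rw [Finset.mem_image] at hv
    obtain ⟨j, -, rfl⟩ := hv
    obtain ⟨e, he, hj⟩ := hL.2 j
    exact Finset.mem_biUnion.2 ⟨e, he, Sym2.mem_toFinset.2 hj⟩
  have h2 := Finset.card_le_card h1
  rw [Finset.card_image_of_injective _ hx.inj, Finset.card_univ, ZMod.card] at h2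
  have h3 : (L.biUnion Sym2.toFinset).card ≤ L.card * 2 := by
    apply Finset.card_biUnion_le_card_mul
    intro e _
    rw [Sym2.card_toFinset]; split_ifs <;> simp
  omega

/-- the perfect matching of the cycle minus `x i` -/
def mat [DecidableEq V] (x : ZMod (2 * n + 1) → V) (i : ZMod (2 * n + 1)) : Finset (Sym2 V) :=
  (oddIdx n i).image (cEdge x)

lemma card_mat [DecidableEq V] (hn : 1 ≤ n) (hx : HasInducedOddCycle G n x)
    (i : ZMod (2 * n + 1)) : (mat x i).card = n := by
  unfold mat
  rw [Finset.card_image_of_injective _ (cEdge_inj hn hx), card_oddIdx]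

lemma mat_sub_cycle [DecidableEq V] (i : ZMod (2 * n + 1)) {e : Sym2 V} (he : e ∈ mat x i) :
    e ∈ cycleEdges n x := by
  unfold mat at he
  obtain ⟨j, -, rfl⟩ := Finset.mem_image.1 he
  exact cEdge_mem_cycle j

lemma mat_sub_edge [DecidableEq V] (hx : HasInducedOddCycle G n x)
    (i : ZMod (2 * n + 1)) {e : Sym2 V} (he : e ∈ mat x i) : e ∈ G.edgeSet := by
  unfold mat at he
  obtain ⟨j, -, rfl⟩ := Finset.mem_image.1 he
  exact cEdge_mem_edgeSet hx j

lemma mat_cover [DecidableEq V] (hx : HasInducedOddCycle G n x)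
    {i j : ZMod (2 * n + 1)} (h : j ≠ i) : ∃ e ∈ mat x i, x j ∈ e := by
  have := oddIdx_cover h
  by_cases h1 : j ∈ oddIdx n i
  · exact ⟨cEdge x j, Finset.mem_image_of_mem _ h1, (mem_cEdge hx).2 (Or.inl rfl)⟩
  · have h2 : j - 1 ∈ oddIdx n i := by tauto
    exact ⟨cEdge x (j - 1), Finset.mem_image_of_mem _ h2, (mem_cEdge hx).2 (Or.inr rfl)⟩

lemma insert_cover [DecidableEq V] (hx : HasInducedOddCycle G n x)
    {i : ZMod (2 * n + 1)} {e : Sym2 V} (he : e ∈ G.edgeSet) (hi : x i ∈ e) :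
    IsEdgeCoverFor G n x (insert e (mat x i)) := by
  refine ⟨?_, ?_⟩
  · intro f hf
    rw [Finset.mem_coe, Finset.mem_insert] at hf
    rcases hf with rfl | hf
    · exact he
    · exact mat_sub_edge hx i hf
  · intro j
    by_cases hj : j = i
    · subst hj; exact ⟨e, Finset.mem_insert_self _ _, hi⟩
    · obtain ⟨f, hf, hf2⟩ := mat_cover hx hj
      exact ⟨f, Finset.mem_insert_of_mem hf, hf2⟩

lemma card_insert_mat_le [DecidableEq V] (hn : 1 ≤ n) (hx : HasInducedOddCycle G n x)
    (i : ZMod (2 * n + 1)) (e : Sym2 V) : (insert e (mat x i)).card ≤ n + 1 := by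
  have := Finset.card_insert_le e (mat x i)
  rw [card_mat hn hx] at this
  exact this

lemma typeI_insert [DecidableEq V] (hn : 1 ≤ n) (hx : HasInducedOddCycle G n x)
    {i j : ZMod (2 * n + 1)} (hi : x i ∈ cEdge x j) :
    IsTypeIMinCover G n x (insert (cEdge x j) (mat x i)) := by
  refine ⟨⟨insert_cover hx (cEdge_mem_edgeSet hx j) hi, ?_⟩, ?_⟩
  · intro f hf
    rw [Finset.mem_coe, Finset.mem_insert] at hf
    rcases hf with rfl | hf
    · exact cEdge_mem_cycle j
    · exact mat_sub_cycle i hf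
  · intro L' hL'
    exact (card_insert_mat_le hn hx i _).trans (cover_card_ge hx hL'.1)

lemma typeII_insert [DecidableEq V] (hn : 1 ≤ n) (hx : HasInducedOddCycle G n x)
    {i : ZMod (2 * n + 1)} {e : Sym2 V} (he : e ∈ G.edgeSet) (hc : e ∉ cycleEdges n x)
    (hi : x i ∈ e) :
    IsTypeIIMinCover G n x (insert e (mat x i)) := by
  refine ⟨⟨insert_cover hx he hi, e, Finset.mem_insert_self _ _, hc⟩, ?_⟩
  intro L' hL'
  exact (card_insert_mat_le hn hx i _).trans (cover_card_ge hx hL'.1)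

/-- structural description of a set of cycle edges covering all but a set of vertices -/
lemma typeII_struct [DecidableEq V] (hn : 1 ≤ n) (hx : HasInducedOddCycle G n x)
    {C : Finset (Sym2 V)} (hC : IsTypeIIMinCover G n x C)
    (hno : ¬ ∃ D : Finset (Sym2 V), IsTypeIMinCover G n x D ∧ D ⊆ C) :
    ∃ i, mat x i ⊆ C ∧ ∃ e ∈ C, e ∉ cycleEdges n x ∧ x i ∈ e := by
  classical
  set Cc := C.filter (fun e => e ∈ cycleEdges n x) with hCc
  set Cn := C.filter (fun e => e ∉ cycleEdges n x) with hCn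
  have hcard : Cc.card + Cn.card = C.card := Finset.card_filter_add_card_filter_not _
  obtain ⟨⟨⟨hCE, hcov⟩, e0, he0, he0c⟩, hmin⟩ := hC
  have hpos : 1 ≤ Cn.card := Finset.card_pos.2 ⟨e0, Finset.mem_filter.2 ⟨he0, he0c⟩⟩
  by_cases hA : ∃ i, ∃ e ∈ G.edgeSet, e ∉ cycleEdges n x ∧ x i ∈ e
  · obtain ⟨i0, e, heG, hec, hie⟩ := hA
    have h1 : C.card ≤ n + 1 :=
      (hmin _ (typeII_insert hn hx heG hec hie).1).trans (card_insert_mat_le hn hx _ _)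
    set S : Finset (ZMod (2 * n + 1)) := Finset.univ.filter (fun j => cEdge x j ∈ C) with hS
    have hSC : S.card ≤ Cc.card := by
      rw [← Finset.card_image_of_injective S (cEdge_inj hn hx)]
      apply Finset.card_le_card
      intro f hf
      obtain ⟨j, hj, rfl⟩ := Finset.mem_image.1 hf
      exact Finset.mem_filter.2 ⟨(Finset.mem_filter.1 hj).2, cEdge_mem_cycle j⟩
    set U : Finset (ZMod (2 * n + 1)) := Finset.univ.filter (fun j => ¬ (j ∈ S ∨ j - 1 ∈ S))
      with hU
    have hUe : ∀ j ∈ U, ∃ e ∈ Cn, x j ∈ e := by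
      intro j hj
      obtain ⟨f, hf, hjf⟩ := hcov j
      refine ⟨f, Finset.mem_filter.2 ⟨hf, ?_⟩, hjf⟩
      rintro ⟨t, rfl⟩
      apply (Finset.mem_filter.1 hj).2
      rcases (mem_cEdge hx (j := t)).1 hjf with h | h
      · left; rw [← h]; exact Finset.mem_filter.2 ⟨Finset.mem_univ _, hf⟩
      · right; rw [← h]; exact Finset.mem_filter.2 ⟨Finset.mem_univ _, hf⟩
    have : Nonempty (Sym2 V) := ⟨e0⟩
    choose! g hg1 hg2 using hUe
    have hUC : U.card ≤ Cn.card := by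
      apply Finset.card_le_card_of_injOn g hg1
      intro a ha b hb hab
      have hb2 := hg2 b hb
      rw [← hab] at hb2
      have hm := Finset.mem_filter.1 (hg1 a ha)
      exact noncycle_unique hx (hCE hm.1) hm.2 (hg2 a ha) hb2
    have hsum := sum_cnt S
    have hge : (Finset.univ.filter (fun j : ZMod (2 * n + 1) => (j ∈ S ∨ j - 1 ∈ S))).card
        ≤ ∑ j, cnt S j := by
      rw [Finset.card_filter]
      apply Finset.sum_le_sum
      intro j _
      unfold cnt
      split_ifs <;> first | omega | tauto
    have htot := Finset.card_filter_add_card_filter_not (s := Finset.univ)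
      (fun j : ZMod (2 * n + 1) => (j ∈ S ∨ j - 1 ∈ S))
    rw [Finset.card_univ, ZMod.card, ← hU] at htot
    have hSn : S.card ≤ n := by omega
    have hU1 : U.card = 1 := by omega
    obtain ⟨i, hi⟩ := Finset.card_eq_one.1 hU1
    have hiU : i ∈ U := by rw [hi]; simp
    have hSO : S = oddIdx n i := by
      apply eq_oddIdx hSn
      intro j hj
      by_contra hh
      have : j ∈ U := Finset.mem_filter.2 ⟨Finset.mem_univ _, hh⟩
      rw [hi] at this
      exact hj (Finset.mem_singleton.1 this)
    refine ⟨i, ?_, g i, (Finset.mem_filter.1 (hg1 i hiU)).1,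
      (Finset.mem_filter.1 (hg1 i hiU)).2, hg2 i hiU⟩
    intro f hf
    unfold mat at hf
    rw [← hSO] at hf
    obtain ⟨j, hj, rfl⟩ := Finset.mem_image.1 hf
    exact (Finset.mem_filter.1 hj).2
  · exfalso
    push Not at hA
    have hCcov : IsTypeICover G n x Cc := by
      refine ⟨⟨fun f hf => hCE (Finset.mem_filter.1 hf).1, ?_⟩, fun f hf => (Finset.mem_filter.1 hf).2⟩
      intro j
      obtain ⟨f, hf, hjf⟩ := hcov j
      refine ⟨f, Finset.mem_filter.2 ⟨hf, ?_⟩, hjf⟩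
      by_contra hfc
      exact hA j f (hCE hf) hfc hjf
    have hI := typeI_insert hn hx (i := 0) (j := 0) ((mem_cEdge hx).2 (Or.inl rfl))
    have hII : IsTypeIICover G n x (insert e0 (insert (cEdge x 0) (mat x 0))) := by
      refine ⟨⟨?_, ?_⟩, e0, Finset.mem_insert_self _ _, he0c⟩
      · intro f hf
        rw [Finset.mem_coe, Finset.mem_insert] at hf
        rcases hf with rfl | hf
        · exact hCE he0
        · exact hI.1.1.1 hf
      · intro j
        obtain ⟨f, hf, hj⟩ := hI.1.1.2 j
        exact ⟨f, Finset.mem_insert_of_mem hf, hj⟩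
    have h1 := hmin _ hII
    have h2 := Finset.card_insert_le e0 (insert (cEdge x 0) (mat x 0))
    have h3 := card_insert_mat_le hn hx 0 (cEdge x 0)
    apply hno
    refine ⟨Cc, ⟨hCcov, ?_⟩, Finset.filter_subset _ _⟩
    intro L' hL'
    have := cover_card_ge hx hL'.1
    omega

lemma main_iff [DecidableEq V] (hn : 1 ≤ n) (hx : HasInducedOddCycle G n x)
    {L : Finset (Sym2 V)} (hL : (↑L : Set (Sym2 V)) ⊆ G.edgeSet) :
    ((∃ C : Finset (Sym2 V), IsTypeIIMinCover G n x C ∧ C ⊆ L) ∧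
        ¬ ∃ C : Finset (Sym2 V), IsTypeIMinCover G n x C ∧ C ⊆ L) ↔
    ∃ i, mat x i ⊆ L ∧ (∃ e ∈ L, e ∉ cycleEdges n x ∧ x i ∈ e) ∧
      cEdge x i ∉ L ∧ cEdge x (i - 1) ∉ L := by
  constructor
  · rintro ⟨⟨C, hC, hCL⟩, hno⟩
    obtain ⟨i, h1, e, he, h2, h3⟩ := typeII_struct hn hx hC
      (fun ⟨D, hD, hDC⟩ => hno ⟨D, hD, hDC.trans hCL⟩)
    refine ⟨i, h1.trans hCL, ⟨e, hCL he, h2, h3⟩, ?_, ?_⟩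
    · intro h
      exact hno ⟨_, typeI_insert hn hx ((mem_cEdge hx).2 (Or.inl rfl)),
        Finset.insert_subset h (h1.trans hCL)⟩
    · intro h
      exact hno ⟨_, typeI_insert hn hx ((mem_cEdge hx).2 (Or.inr rfl)),
        Finset.insert_subset h (h1.trans hCL)⟩
  · rintro ⟨i, h1, ⟨e, he, h2, h3⟩, h4, h5⟩
    refine ⟨⟨_, typeII_insert hn hx (hL he) h2 h3, Finset.insert_subset he h1⟩, ?_⟩
    rintro ⟨C, hC, hCL⟩
    obtain ⟨f, hf, hif⟩ := hC.1.1.2 i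
    obtain ⟨j, rfl⟩ := hC.1.2 hf
    rcases (mem_cEdge hx (j := j)).1 hif with rfl | rfl
    · exact h4 (hCL hf)
    · exact h5 (hCL hf)

end graph

lemma prop_aux1 {o a g p q : Prop} (ha : ¬ a) (hg : g) (h1 : o → ¬ p) (h2 : o → ¬ q) :
    ((o ∨ a) ∨ (True ∧ ¬ (o ∨ p ∨ q))) ↔ (g ∧ ¬ p ∧ ¬ q) := by
  tauto

lemma prop_aux2 {m a nn g c p q : Prop} (hm : ¬ m) (hp : ¬ p) (hq : ¬ q) (h1 : a → nn)
    (h2 : nn ↔ g ∧ ¬ c) (hc : ¬ c) : ((m ∨ a) ∨ (nn ∧ ¬ a)) ↔ (g ∧ ¬ p ∧ ¬ q) := by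
  tauto

/-- counting edge subsets of `G` of size `n+k` that contain a Type-II minimum edge
cover but no Type-I minimum edge cover of the induced odd cycle `C_{2n+1}`.  The sum runs over
the cycle vertices `x i`; `li i` is the number of edges of `G' = G ∖ E(C_{2n+1})` incident to
`x i` (vertices with `li i = 0` contribute empty inner sums), and `ui i = (n-1) + (l - li i)`. -/
theorem count_typeII_not_typeI_supersets {V : Type} [Fintype V] [DecidableEq V]
    (G : SimpleGraph V) (n : ℕ) (hn : 1 ≤ n) (x : ZMod (2 * n + 1) → V)
    (hx : HasInducedOddCycle G n x)
    (l : ℕ) (hl : l = {e : Sym2 V | e ∈ G.edgeSet ∧ e ∉ cycleEdges n x}.ncard)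
    (li : ZMod (2 * n + 1) → ℕ)
    (hli : ∀ i, li i = {e : Sym2 V | e ∈ G.edgeSet ∧ e ∉ cycleEdges n x ∧ x i ∈ e}.ncard)
    (ui : ZMod (2 * n + 1) → ℕ) (hui : ∀ i, ui i = (n - 1) + (l - li i))
    (d'' : ℕ → ℕ)
    (hd'' : ∀ j : ℕ, d'' j =
      {L : Finset (Sym2 V) | (↑L : Set (Sym2 V)) ⊆ G.edgeSet ∧ L.card = j ∧
        (∃ C : Finset (Sym2 V), IsTypeIIMinCover G n x C ∧ C ⊆ L) ∧
        ¬ ∃ C : Finset (Sym2 V), IsTypeIMinCover G n x C ∧ C ⊆ L}.ncard) :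
    ∀ k : ℕ, 1 ≤ k → k ≤ n - 1 + l →
      d'' (n + k) = ∑ i : ZMod (2 * n + 1), ∑ j ∈ Finset.Icc 1 (li i),
        Nat.choose (li i) j * (if j ≤ k then Nat.choose (ui i) (k - j) else 0) := by
  classical
  intro k hk _
  set E : Finset (Sym2 V) := G.edgeSet.toFinset with hE
  set N : Finset (Sym2 V) := E.filter (fun e => e ∉ cycleEdges n x) with hN
  let A : ZMod (2 * n + 1) → Finset (Sym2 V) := fun i => N.filter (fun e => x i ∈ e)
  let Rc : ZMod (2 * n + 1) → Finset (Sym2 V) := fun i =>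
    (Finset.univ \ (oddIdx n i ∪ {i, i - 1})).image (cEdge x)
  let R : ZMod (2 * n + 1) → Finset (Sym2 V) := fun i => (N \ A i) ∪ Rc i
  have hmE : ∀ e, e ∈ E ↔ e ∈ G.edgeSet := fun e => by simp [hE]
  have hmN : ∀ e, e ∈ N ↔ e ∈ G.edgeSet ∧ e ∉ cycleEdges n x := fun e => by
    rw [hN, Finset.mem_filter, hmE]
  have hmA : ∀ i e, e ∈ A i ↔ (e ∈ G.edgeSet ∧ e ∉ cycleEdges n x) ∧ x i ∈ e := fun i e => by
    rw [← hmN]; exact Finset.mem_filter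
  have hAN : ∀ i, A i ⊆ N := fun i => Finset.filter_subset _ _
  have hlN : l = N.card := by
    rw [hl, ← Set.ncard_coe_finset]; congr 1; ext e; exact (hmN e).symm
  have hlA : ∀ i, li i = (A i).card := by
    intro i
    rw [hli, ← Set.ncard_coe_finset]; congr 1; ext e
    rw [Finset.mem_coe, hmA]; exact and_assoc.symm
  have hne : ∀ i : ZMod (2 * n + 1), i ≠ i - 1 := by
    intro i h
    have h3 : ((1 : ℕ) : ZMod (2 * n + 1)) = 0 := by push_cast; linear_combination h
    have := congrArg ZMod.val h3
    rw [ZMod.val_cast_of_lt (by omega)] at this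
    simp at this
  have hRcN : ∀ i e, e ∈ Rc i → e ∈ cycleEdges n x := by
    intro i e he
    obtain ⟨j, -, rfl⟩ := Finset.mem_image.1 he
    exact cEdge_mem_cycle j
  have hRc : ∀ i, (Rc i).card = n - 1 := by
    intro i
    show (Finset.image _ _).card = _
    rw [Finset.card_image_of_injective _ (cEdge_inj hn hx),
      Finset.card_sdiff_of_subset (Finset.subset_univ _), Finset.card_union_of_disjoint,
      Finset.card_univ, ZMod.card, card_oddIdx, Finset.card_pair (hne i)]
    · omega
    · simp [Finset.disjoint_right, self_not_mem_oddIdx, pred_not_mem_oddIdx]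
  have hR : ∀ i, (R i).card = ui i := by
    intro i
    show ((N \ A i) ∪ Rc i).card = _
    rw [Finset.card_union_of_disjoint, Finset.card_sdiff_of_subset (hAN i), hRc, hui, hlN, hlA]
    · omega
    · rw [Finset.disjoint_left]
      intro e he he2
      exact ((hmN e).1 (Finset.mem_sdiff.1 he).1).2 (hRcN i e he2)
  have hMA : ∀ i, Disjoint (mat x i) (A i) := by
    intro i
    rw [Finset.disjoint_left]
    intro e he he2
    exact ((hmA i e).1 he2).1.2 (mat_sub_cycle i he)
  have hMR : ∀ i, Disjoint (mat x i) (R i) := by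
    intro i
    rw [Finset.disjoint_left]
    intro e he he2
    rcases Finset.mem_union.1 he2 with h | h
    · exact ((hmN e).1 (Finset.mem_sdiff.1 h).1).2 (mat_sub_cycle i he)
    · obtain ⟨j, hj, rfl⟩ := Finset.mem_image.1 h
      obtain ⟨j', hj', hjj⟩ := Finset.mem_image.1 he
      have := cEdge_inj hn hx hjj
      subst this
      exact (Finset.mem_sdiff.1 hj).2 (Finset.mem_union_left _ hj')
  have hAR : ∀ i, Disjoint (A i) (R i) := by
    intro i
    rw [Finset.disjoint_left]
    intro e he he2
    rcases Finset.mem_union.1 he2 with h | h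
    · exact (Finset.mem_sdiff.1 h).2 he
    · exact ((hmA i e).1 he).1.2 (hRcN i e h)
  have hU : ∀ i e, e ∈ mat x i ∪ A i ∪ R i ↔
      e ∈ G.edgeSet ∧ e ≠ cEdge x i ∧ e ≠ cEdge x (i - 1) := by
    intro i e
    by_cases hec : e ∈ cycleEdges n x
    · obtain ⟨j, rfl⟩ := mem_cycle_iff.1 hec
      have h1 : cEdge x j ∈ mat x i ↔ j ∈ oddIdx n i :=
        Function.Injective.mem_finset_image (cEdge_inj hn hx)
      have h2 : cEdge x j ∉ A i := fun h => ((hmA i _).1 h).1.2 hec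
      have h2' : cEdge x j ∉ N := fun h => ((hmN _).1 h).2 hec
      have h3 : cEdge x j ∈ Rc i ↔ j ∈ (Finset.univ \ (oddIdx n i ∪ {i, i - 1})) :=
        Function.Injective.mem_finset_image (cEdge_inj hn hx)
      have h4 : cEdge x j ∈ R i ↔ cEdge x j ∈ Rc i := by
        show _ ∈ (N \ A i) ∪ Rc i ↔ _
        simp [h2']
      rw [Finset.mem_union, Finset.mem_union, h1, h4, h3, (cEdge_inj hn hx).ne_iff,
        (cEdge_inj hn hx).ne_iff]
      have h5 := cEdge_mem_edgeSet hx j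
      have h6 : j ∈ oddIdx n i → j ≠ i := by rintro h rfl; exact self_not_mem_oddIdx n _ h
      have h7 : j ∈ oddIdx n i → j ≠ i - 1 := by rintro h rfl; exact pred_not_mem_oddIdx n _ h
      simp only [Finset.mem_sdiff, Finset.mem_univ, Finset.mem_union, Finset.mem_insert,
        Finset.mem_singleton]
      exact prop_aux1 h2 h5 h6 h7
    · have h1 : e ∉ mat x i := fun h => hec (mat_sub_cycle i h)
      have h2 : e ∉ Rc i := fun h => hec (hRcN i e h)
      have h3 : e ≠ cEdge x i := by rintro rfl; exact hec (cEdge_mem_cycle _)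
      have h4 : e ≠ cEdge x (i - 1) := by rintro rfl; exact hec (cEdge_mem_cycle _)
      have h5 : e ∈ R i ↔ e ∈ N ∧ e ∉ A i := by
        show _ ∈ (N \ A i) ∪ Rc i ↔ _
        simp [h2]
      have h6 := @hAN i e
      have h7 := hmN e
      rw [Finset.mem_union, Finset.mem_union, h5]
      exact prop_aux2 h1 h3 h4 h6 h7 hec
  let F : ZMod (2 * n + 1) → Finset (Finset (Sym2 V)) := fun i =>
    ((mat x i ∪ A i ∪ R i).powerset).filter
      (fun L => L.card = (mat x i).card + k ∧ mat x i ⊆ L ∧ (L ∩ A i).Nonempty)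
  have hF : ∀ i L, L ∈ F i ↔ (↑L : Set (Sym2 V)) ⊆ G.edgeSet ∧ L.card = n + k ∧ mat x i ⊆ L ∧
      (∃ e ∈ L, e ∉ cycleEdges n x ∧ x i ∈ e) ∧ cEdge x i ∉ L ∧ cEdge x (i - 1) ∉ L := by
    intro i L
    show L ∈ Finset.filter _ _ ↔ _
    rw [Finset.mem_filter, Finset.mem_powerset, card_mat hn hx]
    constructor
    · rintro ⟨h1, h2, h3, e, he⟩
      rw [Finset.mem_inter, hmA] at he
      refine ⟨fun f hf => ((hU i f).1 (h1 hf)).1, h2, h3, ⟨e, he.1, he.2.1.2, he.2.2⟩, ?_, ?_⟩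
      · intro h; exact ((hU i _).1 (h1 h)).2.1 rfl
      · intro h; exact ((hU i _).1 (h1 h)).2.2 rfl
    · rintro ⟨h1, h2, h3, ⟨e, he, he2, he3⟩, h4, h5⟩
      refine ⟨fun f hf => (hU i f).2 ⟨h1 hf, ?_, ?_⟩, h2, h3, e, ?_⟩
      · rintro rfl; exact h4 hf
      · rintro rfl; exact h5 hf
      · rw [Finset.mem_inter, hmA]; exact ⟨he, ⟨h1 he, he2⟩, he3⟩
  have hset : {L : Finset (Sym2 V) | (↑L : Set (Sym2 V)) ⊆ G.edgeSet ∧ L.card = n + k ∧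
        (∃ C : Finset (Sym2 V), IsTypeIIMinCover G n x C ∧ C ⊆ L) ∧
        ¬ ∃ C : Finset (Sym2 V), IsTypeIMinCover G n x C ∧ C ⊆ L} =
      ((Finset.univ.biUnion F : Finset (Finset (Sym2 V))) : Set (Finset (Sym2 V))) := by
    ext L
    rw [Finset.mem_coe, Finset.mem_biUnion]
    constructor
    · rintro ⟨h1, h2, h3⟩
      obtain ⟨i, hi⟩ := (main_iff hn hx h1).1 h3
      exact ⟨i, Finset.mem_univ _, (hF i L).2 ⟨h1, h2, hi⟩⟩
    · rintro ⟨i, -, hi⟩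
      obtain ⟨h1, h2, h3⟩ := (hF i L).1 hi
      exact ⟨h1, h2, (main_iff hn hx h1).2 ⟨i, h3⟩⟩
  rw [hd'', hset, Set.ncard_coe_finset, Finset.card_biUnion]
  · refine Finset.sum_congr rfl fun i _ => ?_
    rw [hlA, ← hR]
    exact count_generic (mat x i) (A i) (R i) (hMA i) (hMR i) (hAR i) k
  · intro i _ i' _ hii
    rw [Function.onFun, Finset.disjoint_left]
    intro L h1 h2
    obtain ⟨-, -, -, -, h4, h5⟩ := (hF i L).1 h1
    obtain ⟨-, -, h6, -⟩ := (hF i' L).1 h2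
    obtain ⟨e, he, hie⟩ := mat_cover hx hii
    obtain ⟨j, rfl⟩ := mem_cycle_iff.1 (mat_sub_cycle i' he)
    rcases (mem_cEdge hx (j := j)).1 hie with rfl | rfl
    · exact h4 (h6 he)
    · exact h5 (h6 he)

end
end

section
/- Let I = (g_1,…,g_{2n+1}) ⊆ 𝕜[x_1,…,x_{2n+1}] be the edge ideal of the odd cycle C_{2n+1} = (x_1,…,x_{2n+1}), where g_j = x_j x_{j+1} for 1 ≤ j ≤ 2n and g_{2n+1} = x_{2n+1} x_1. Then every minimal monomial generator M of I^s has a unique expression of the form M = g_1^{α_1}⋯g_{2n+1}^{α_{2n+1}} with Σ_{i=1}^{2n+1} α_i = s; that is, if g_1^{α_1}⋯g_{2n+1}^{α_{2n+1}} = g_1^{β_1}⋯g_{2n+1}^{β_{2n+1}} with Σα_i = Σβ_i = s, then α_i = β_i for all i. -/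
open MvPolynomial

noncomputable section

/-- uniqueness of expressions of minimal monomial generators of powers of the
edge ideal `I = (g_1, …, g_{2n+1})` of the odd cycle `C_{2n+1}`, where `g_j = x_j x_{j+1}`
(indices mod `2n+1`): if `g_1^{α_1} ⋯ g_{2n+1}^{α_{2n+1}} = g_1^{β_1} ⋯ g_{2n+1}^{β_{2n+1}}`
with `Σ α_i = Σ β_i = s`, then `α_i = β_i` for all `i`. -/
theorem cycle_edge_ideal_unique_expression (𝕜 : Type) [Field 𝕜] (n : ℕ) (hn : 1 ≤ n)
    (g : ZMod (2 * n + 1) → MvPolynomial (ZMod (2 * n + 1)) 𝕜)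
    (hg : ∀ j : ZMod (2 * n + 1), g j = X j * X (j + 1))
    (I : Ideal (MvPolynomial (ZMod (2 * n + 1)) 𝕜)) (hI : I = Ideal.span (Set.range g))
    (s : ℕ) (α β : ZMod (2 * n + 1) → ℕ)
    (hα : ∑ i : ZMod (2 * n + 1), α i = s) (hβ : ∑ i : ZMod (2 * n + 1), β i = s)
    (h : ∏ i : ZMod (2 * n + 1), g i ^ α i = ∏ i : ZMod (2 * n + 1), g i ^ β i) :
    α = β := by
  classical
  have mon : ∀ γ : ZMod (2 * n + 1) → ℕ, ∏ i : ZMod (2 * n + 1), g i ^ γ i =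
      monomial (∑ i : ZMod (2 * n + 1),
        γ i • (Finsupp.single i 1 + Finsupp.single (i + 1) 1)) (1 : 𝕜) := by
    intro γ
    rw [monomial_sum_one]
    refine Finset.prod_congr rfl fun i _ => ?_
    rw [hg i, X, X, monomial_mul, monomial_pow]
    simp
  rw [mon, mon] at h
  have h2 := monomial_left_injective (one_ne_zero : (1 : 𝕜) ≠ 0) h
  have co : ∀ (γ : ZMod (2 * n + 1) → ℕ) (j : ZMod (2 * n + 1)),
      (∑ i : ZMod (2 * n + 1),
        γ i • (Finsupp.single i 1 + Finsupp.single (i + 1) 1 : ZMod (2 * n + 1) →₀ ℕ)) (j + 1)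
        = γ (j + 1) + γ j := by
    intro γ j
    simp [Finsupp.finsetSum_apply, Finsupp.single_apply, mul_add, Finset.sum_add_distrib]
  have key : ∀ j, (α (j + 1) : ℤ) - β (j + 1) = -((α j : ℤ) - β j) := by
    intro j
    have h3 := DFunLike.congr_fun h2 (j + 1)
    rw [co, co] at h3
    omega
  have it : ∀ (k : ℕ) (j : ZMod (2 * n + 1)),
      (α (j + k) : ℤ) - β (j + k) = (-1) ^ k * ((α j : ℤ) - β j) := by
    intro k j
    induction k with
    | zero => simp
    | succ k ih =>
      have := key (j + k)
      rw [ih] at this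
      rw [Nat.cast_succ, ← add_assoc, this, pow_succ]
      ring
  funext j
  have h4 := it (2 * n + 1) j
  rw [ZMod.natCast_self, add_zero, Odd.neg_one_pow ⟨n, rfl⟩] at h4
  omega

end
end

section
/- Let G be a unicyclic graph whose unique cycle is the odd cycle C_{2n+1} = (x_1,…,x_{2n+1}) (n ≥ 1), and let I = I(G) be its edge ideal with minimal generators g_1,…,g_q. Then for every s ≥ 1 and all nonnegative integers α_1,…,α_q with Σ_{i=1}^{q} α_i = s, the monomial g_1^{α_1}⋯g_q^{α_q} is a minimal generator of I^s, and the exponent vector (α_1,…,α_q) is uniquely determined by the monomial; that is, distinct exponent vectors summing to s give distinct monomials. -/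
open MvPolynomial

noncomputable section

/-- The edge ideal of a simple graph: `I(G) = ⟨X_u · X_v : {u,v} ∈ E(G)⟩`. -/
def edgeIdeal (𝕜 : Type) [Field 𝕜] {V : Type} (G : SimpleGraph V) :
    Ideal (MvPolynomial V 𝕜) :=
  Ideal.span {p | ∃ u v : V, G.Adj u v ∧ p = X u * X v}

/-- `G` is a unicyclic graph (connected with exactly one cycle, equivalently connected with as
many edges as vertices) whose unique cycle is the odd cycle `C_{2n+1}` on the vertices `x j`. -/
structure IsUnicyclicOddCycle {V : Type} [Fintype V] (G : SimpleGraph V) (n : ℕ)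
    (x : ZMod (2 * n + 1) → V) : Prop where
  connected : G.Connected
  edge_count : G.edgeSet.ncard = Fintype.card V
  inj : Function.Injective x
  adj_iff : ∀ i j : ZMod (2 * n + 1), G.Adj (x i) (x j) ↔ (j = i + 1 ∨ i = j + 1)

/-- `f` is a minimal monomial generator of the monomial ideal `J`: it is a monic monomial
belonging to `J` such that no monic monomial of `J` properly divides it. -/
def IsMinMonomialGen {𝕜 : Type} [Field 𝕜] {V : Type} (J : Ideal (MvPolynomial V 𝕜))
    (f : MvPolynomial V 𝕜) : Prop :=
  (∃ m : V →₀ ℕ, f = monomial m 1) ∧ f ∈ J ∧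
    ∀ g : MvPolynomial V 𝕜, (∃ m : V →₀ ℕ, g = monomial m 1) → g ∈ J → g ∣ f → g = f

/-- The monomial `X_u · X_v` associated to an edge `{u,v}`. -/
def edgeMonomial (𝕜 : Type) [Field 𝕜] {V : Type} (e : Sym2 V) : MvPolynomial V 𝕜 :=
  Sym2.lift ⟨fun u v => X u * X v, fun _ _ => mul_comm _ _⟩ e

/-- Exponent vector of an edge monomial. -/
def edgeExp {V : Type} (e : Sym2 V) : V →₀ ℕ :=
  Sym2.lift ⟨fun u v => Finsupp.single u 1 + Finsupp.single v 1, fun _ _ => add_comm _ _⟩ e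

/-- The sum of the values of `y` on the two ends of an edge. -/
def edgeSum {V : Type} (y : V → ℚ) (e : Sym2 V) : ℚ :=
  Sym2.lift ⟨fun u v => y u + y v, fun _ _ => add_comm _ _⟩ e

/-- The linear functional on exponent vectors given by `y`. -/
def expFun {V : Type} (y : V → ℚ) : (V →₀ ℕ) →+ ℚ :=
  Finsupp.liftAddHom fun v => (AddMonoidHom.mulLeft (y v)).comp (Nat.castAddMonoidHom ℚ)

lemma expFun_edgeExp {V : Type} (y : V → ℚ) (e : Sym2 V) :
    expFun y (edgeExp e) = edgeSum y e := by
  induction e using Sym2.ind with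
  | _ u v =>
    change expFun y (Finsupp.single u 1 + Finsupp.single v 1) = y u + y v
    rw [map_add]
    simp [expFun]

lemma degree_edgeExp {V : Type} (e : Sym2 V) : (edgeExp e).degree = 2 := by
  induction e using Sym2.ind with
  | _ u v => simp [edgeExp]

lemma edgeMonomial_eq (𝕜 : Type) [Field 𝕜] {V : Type} (e : Sym2 V) :
    edgeMonomial 𝕜 e = monomial (edgeExp e) 1 := by
  induction e using Sym2.ind with
  | _ u v => simp [edgeMonomial, edgeExp, X, monomial_mul]

lemma prod_edgeMonomial (𝕜 : Type) [Field 𝕜] {V : Type} (E : Finset (Sym2 V)) (α : E → ℕ) :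
    (∏ e : E, edgeMonomial 𝕜 (e : Sym2 V) ^ α e) =
      monomial (∑ e : E, α e • edgeExp (e : Sym2 V)) 1 := by
  rw [monomial_sum_one]
  refine Finset.prod_congr rfl fun e _ => ?_
  rw [edgeMonomial_eq, monomial_pow, one_pow]

lemma edgeIdeal_pow_le (𝕜 : Type) [Field 𝕜] {V : Type} (G : SimpleGraph V) (s : ℕ) :
    edgeIdeal 𝕜 G ^ s ≤ idealOfVars V 𝕜 ^ (2 * s) := by
  rw [pow_mul]
  refine Ideal.pow_right_mono ?_ s
  refine Ideal.span_le.2 ?_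
  rintro p ⟨u, v, -, rfl⟩
  rw [pow_two]
  exact Ideal.mul_mem_mul (Ideal.subset_span ⟨u, rfl⟩) (Ideal.subset_span ⟨v, rfl⟩)

lemma edgeSum_injective {V : Type} [Fintype V] (G : SimpleGraph V) (n : ℕ)
    (x : ZMod (2 * n + 1) → V) (hx : IsUnicyclicOddCycle G n x) (y : V → ℚ)
    (hy : ∀ u v, G.Adj u v → y u + y v = 0) : y = 0 := by
  have h1 : ∀ k : ℕ, y (x (k : ZMod (2 * n + 1))) = (-1) ^ k * y (x 0) := by
    intro k
    induction k with
    | zero => simp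
    | succ k ih =>
      have := hy _ _ ((hx.adj_iff (k : ZMod (2 * n + 1)) (k + 1)).2 (Or.inl rfl))
      push_cast
      rw [pow_succ]
      linarith
  have h2 := h1 (2 * n + 1)
  rw [ZMod.natCast_self, pow_succ, pow_mul] at h2
  have h0 : y (x 0) = 0 := by
    norm_num at h2
    linarith
  funext w
  obtain ⟨p⟩ := hx.connected.preconnected (x 0) w
  have : ∀ a b : V, G.Walk a b → y a = 0 → y b = 0 := by
    intro a b p
    induction p with
    | nil => exact id
    | cons h p ih =>
      intro h'
      apply ih
      have := hy _ _ h
      linarith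
  exact this _ _ p h0

lemma exists_dual {V : Type} [Fintype V] [DecidableEq V] (G : SimpleGraph V)
    [DecidableRel G.Adj] (n : ℕ)
    (x : ZMod (2 * n + 1) → V) (hx : IsUnicyclicOddCycle G n x) (z : G.edgeFinset → ℚ) :
    ∃ y : V → ℚ, ∀ e : G.edgeFinset, edgeSum y (e : Sym2 V) = z e := by
  let T : (V → ℚ) →ₗ[ℚ] (G.edgeFinset → ℚ) :=
    { toFun := fun y e => edgeSum y (e : Sym2 V)
      map_add' := by
        intro a b
        funext e
        obtain ⟨e, he⟩ := e
        induction e using Sym2.ind with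
        | _ u v => simp [edgeSum]; ring
      map_smul' := by
        intro c b
        funext e
        obtain ⟨e, he⟩ := e
        induction e using Sym2.ind with
        | _ u v => simp [edgeSum]; ring }
  have hinj : Function.Injective T := by
    rw [← LinearMap.ker_eq_bot, LinearMap.ker_eq_bot']
    intro y hy
    refine edgeSum_injective G n x hx y fun u v huv => ?_
    exact congrFun hy ⟨s(u, v), by simpa using huv⟩
  have hcard : Module.finrank ℚ (V → ℚ) = Module.finrank ℚ (G.edgeFinset → ℚ) := by
    have := hx.edge_count
    rw [← SimpleGraph.coe_edgeFinset, Set.ncard_coe_finset] at this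
    rw [Module.finrank_fintype_fun_eq_card, Module.finrank_fintype_fun_eq_card, Fintype.card_coe, this]
  have hsurj := (LinearMap.injective_iff_surjective_of_finrank_eq_finrank hcard).1 hinj
  obtain ⟨y, hy⟩ := hsurj z
  exact ⟨y, fun e => congrFun hy e⟩

/-- for the edge ideal `I` of a unicyclic graph `G` with unique odd cycle
`C_{2n+1}`, every product `g_1^{α_1} ⋯ g_q^{α_q}` of the minimal (edge) generators of `I` with
`Σ α_i = s ≥ 1` is a minimal monomial generator of `I^s`, and the exponent vector is uniquely
determined by the monomial. -/
theorem unicyclic_power_unique_expression {V : Type} [Fintype V] [DecidableEq V]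
    (𝕜 : Type) [Field 𝕜] (G : SimpleGraph V) [DecidableRel G.Adj] (n : ℕ) (hn : 1 ≤ n)
    (x : ZMod (2 * n + 1) → V) (hx : IsUnicyclicOddCycle G n x)
    (s : ℕ) (hs : 1 ≤ s) (α : G.edgeFinset → ℕ) (hα : ∑ e, α e = s) :
    IsMinMonomialGen ((edgeIdeal 𝕜 G) ^ s)
      (∏ e : G.edgeFinset, edgeMonomial 𝕜 (e : Sym2 V) ^ α e) ∧
    ∀ β : G.edgeFinset → ℕ, (∑ e, β e = s) →
      (∏ e : G.edgeFinset, edgeMonomial 𝕜 (e : Sym2 V) ^ α e) =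
        (∏ e : G.edgeFinset, edgeMonomial 𝕜 (e : Sym2 V) ^ β e) → α = β := by
  subst hα
  refine ⟨⟨⟨_, prod_edgeMonomial 𝕜 _ α⟩, ?_, ?_⟩, ?_⟩
  · rw [← Finset.prod_pow_eq_pow_sum]
    refine Ideal.prod_mem_prod fun e _ => Ideal.pow_mem_pow ?_ _
    obtain ⟨e, he⟩ := e
    induction e using Sym2.ind with
    | _ u v => exact Ideal.subset_span ⟨u, v, by simpa using he, rfl⟩
  · rintro g ⟨m, rfl⟩ hg hdvd
    rw [prod_edgeMonomial] at hdvd ⊢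
    rw [monomial_one_dvd_monomial_one] at hdvd
    have hdeg := (mem_pow_idealOfVars_iff _ _).1 (edgeIdeal_pow_le 𝕜 G _ hg) m (by simp)
    obtain ⟨c, hc⟩ := le_iff_exists_add.1 hdvd
    have h2 := congrArg Finsupp.degree hc
    simp only [map_add, map_sum, map_nsmul, degree_edgeExp, smul_eq_mul, ← Finset.sum_mul] at h2
    have : c.degree = 0 := by omega
    rw [Finsupp.degree_eq_zero_iff] at this
    rw [hc, this, add_zero]
  · intro β _ h
    rw [prod_edgeMonomial, prod_edgeMonomial] at h
    have h' := monomial_left_injective (one_ne_zero) h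
    funext e
    obtain ⟨y, hy⟩ := exists_dual G n x hx (Pi.single e 1)
    have h3 := congrArg (expFun y) h'
    simp only [map_sum, map_nsmul, expFun_edgeExp, hy] at h3
    simpa [Pi.single_apply] using h3

end
end

section
/- Let G be a unicyclic graph whose unique cycle is the odd cycle C_{2n+1} = (x_1,…,x_{2n+1}) (n ≥ 1), let I = I(G) be its edge ideal, and let c = x_1⋯x_{2n+1}. Let s ∈ ℕ and write s = k(n+1) + r with k ∈ ℤ and 0 ≤ r ≤ n. Then for every t with 2 ≤ t ≤ k−1, every minimal monomial generator of I^{s−(n+1)} that belongs to the ideal I^{s−(n+1)−t(n+1)}·(c)^t also belongs to the ideal I^{s−2(n+1)}·(c). -/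
open MvPolynomial

noncomputable section

instance edgeFin {V : Type} [Fintype V] (G : SimpleGraph V) : Fintype G.edgeSet :=
  Fintype.ofFinite _

open Classical in
/-- vertex-edge incidence map -/
def inc {V : Type} [Fintype V] (G : SimpleGraph V) (K : Type) [CommSemiring K]
    (a : G.edgeSet → K) : V → K :=
  fun v => ∑ e, a e * (if v ∈ (e : Sym2 V) then 1 else 0)

open Classical in
def sg {V : Type} (K : Type) [CommSemiring K] (v : V) : V → K := Pi.single v 1

def cC {V : Type} (K : Type) [CommSemiring K] (n : ℕ) (x : ZMod (2 * n + 1) → V) : V → K :=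
  ∑ j, sg K (x j)

section
variable {V : Type} [Fintype V] {G : SimpleGraph V} {n : ℕ} {x : ZMod (2 * n + 1) → V}

lemma inc_add {K : Type} [CommSemiring K] (a b : G.edgeSet → K) :
    inc G K (a + b) = inc G K a + inc G K b := by
  ext v; simp only [inc, Pi.add_apply, add_mul, Finset.sum_add_distrib]

lemma inc_smul {K : Type} [CommSemiring K] (r : K) (a : G.edgeSet → K) :
    inc G K (r • a) = r • inc G K a := by
  ext v; simp only [inc, Pi.smul_apply, smul_eq_mul, Finset.mul_sum, mul_assoc]

def incL (G : SimpleGraph V) (K : Type) [CommSemiring K] : (G.edgeSet → K) →ₗ[K] (V → K) where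
  toFun := inc G K
  map_add' := inc_add
  map_smul' := inc_smul

lemma inc_eq {K : Type} [CommSemiring K] (a : G.edgeSet → K) : inc G K a = incL G K a := rfl

lemma inc_cast (a : G.edgeSet → ℕ) (v : V) :
    inc G ℚ (fun e => (a e : ℚ)) v = (inc G ℕ a v : ℚ) := by
  simp [inc]

open Classical in
lemma inc_single {K : Type} [CommSemiring K] (u v : V) (h : G.Adj u v) :
    inc G K (Pi.single ⟨s(u, v), h⟩ 1) = sg K u + sg K v := by
  ext w
  have hne := h.ne
  simp only [inc, sg, Pi.add_apply]
  rw [Finset.sum_eq_single ⟨s(u, v), h⟩]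
  · simp only [Pi.single_eq_same, one_mul, Sym2.mem_iff]
    by_cases h1 : w = u
    · subst h1; simp [hne]
    · by_cases h2 : w = v
      · subst h2; simp [h1]
      · simp [h1, h2]
  · intro e _ he; simp [he]
  · simp

lemma sum_sg {K : Type} [CommSemiring K] (v : V) : ∑ w, sg K v w = 1 := by
  classical
  simp [sg]

lemma sum_cC {K : Type} [CommSemiring K] (x : ZMod (2 * n + 1) → V) :
    ∑ w, cC K n x w = 2 * n + 1 := by
  classical
  simp only [cC, Finset.sum_apply]
  rw [Finset.sum_comm]
  simp [sum_sg, ZMod.card]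

lemma sum_inc (a : G.edgeSet → ℕ) : ∑ v, inc G ℕ a v = 2 * ∑ e, a e := by
  classical
  simp only [inc]
  rw [Finset.sum_comm, Finset.mul_sum]
  refine Finset.sum_congr rfl ?_
  rintro ⟨e, he⟩ _
  induction e with
  | _ u v =>
  rw [← Finset.mul_sum, mul_comm]
  congr 1
  have hne : u ≠ v := G.ne_of_adj he
  rw [Finset.sum_boole]
  have : (Finset.univ.filter fun w => w ∈ s(u, v)) = {u, v} := by ext; simp
  rw [this, Finset.card_pair hne]; rfl

lemma sum_zmod {M : Type} [AddCommMonoid M] (g : ZMod (2 * n + 1) → M) (i : ZMod (2 * n + 1)) :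
    ∑ l ∈ Finset.range (2 * n + 1), g (i + l) = ∑ j, g j := by
  rw [← Equiv.sum_comp (Equiv.addLeft i)]
  symm
  refine Finset.sum_nbij' (fun j => j.val) (fun l => (l : ZMod (2 * n + 1))) ?_ ?_ ?_ ?_ ?_
  · intro a _; simpa using ZMod.val_lt a
  · simp
  · simp
  · intro l hl; exact ZMod.val_cast_of_lt (by simpa using hl)
  · simp

lemma sum_pairs {M : Type} [AddCommMonoid M] (g : ℕ → M) (N : ℕ) :
    ∑ k ∈ Finset.range N, (g (2 * k) + g (2 * k + 1)) = ∑ l ∈ Finset.range (2 * N), g l := by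
  induction N with
  | zero => simp
  | succ N ih =>
    rw [Finset.sum_range_succ, ih, show 2 * (N + 1) = 2 * N + 1 + 1 by ring,
      Finset.sum_range_succ, Finset.sum_range_succ, add_assoc]

/-- edge inside the cycle -/
def Cyc (x : ZMod (2 * n + 1) → V) (e : G.edgeSet) : Prop := ∀ v ∈ (e : Sym2 V), v ∈ Set.range x
/-- edge meeting the cycle -/
def Meets (x : ZMod (2 * n + 1) → V) (e : G.edgeSet) : Prop := ∃ v ∈ (e : Sym2 V), v ∈ Set.range x

lemma Cyc.meets {e : G.edgeSet} (h : Cyc x e) : Meets x e := by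
  obtain ⟨e, he⟩ := e
  induction e with
  | _ u v => exact ⟨u, by simp, h u (by simp)⟩

lemma exists_even (hx : IsUnicyclicOddCycle G n x) (i : ZMod (2 * n + 1)) :
    ∃ h : G.edgeSet → ℕ, ∑ e, h e = n + 1 ∧ (∀ e, ¬ Cyc x e → h e = 0) ∧
      inc G ℕ h = cC ℕ n x + sg ℕ (x i) := by
  classical
  have hadj : ∀ j, G.Adj (x j) (x (j + 1)) := fun j => (hx.adj_iff _ _).2 (Or.inl rfl)
  refine ⟨∑ k ∈ Finset.range (n + 1), Pi.single ⟨s(x (i + (2 * k : ℕ)), x (i + (2 * k : ℕ) + 1)), hadj _⟩ 1,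
    ?_, ?_, ?_⟩
  · simp only [Finset.sum_apply]
    rw [Finset.sum_comm]
    simp
  · intro e he
    simp only [Finset.sum_apply]
    refine Finset.sum_eq_zero fun k _ => ?_
    rw [Pi.single_eq_of_ne]
    rintro rfl
    apply he
    intro v hv
    simp only [Sym2.mem_iff] at hv
    rcases hv with rfl | rfl <;> simp
  · rw [inc_eq, map_sum]
    simp only [← inc_eq, inc_single]
    have := sum_pairs (fun l : ℕ => sg ℕ (x (i + l))) (n + 1)
    simp only [Nat.cast_add, Nat.cast_one, ← add_assoc] at this
    rw [this, show 2 * (n + 1) = 2 * n + 1 + 1 by ring, Finset.sum_range_succ,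
      sum_zmod (fun j => sg ℕ (x j)) i]
    have h0 : ((2 * n + 1 : ℕ) : ZMod (2 * n + 1)) = 0 := ZMod.natCast_self _
    rw [h0, add_zero]; rfl

lemma exists_odd (hx : IsUnicyclicOddCycle G n x) (i : ZMod (2 * n + 1)) :
    ∃ h : G.edgeSet → ℕ, ∑ e, h e = n ∧ (∀ e, ¬ Cyc x e → h e = 0) ∧
      inc G ℕ h + sg ℕ (x i) = cC ℕ n x := by
  classical
  have hadj : ∀ j, G.Adj (x j) (x (j + 1)) := fun j => (hx.adj_iff _ _).2 (Or.inl rfl)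
  refine ⟨∑ k ∈ Finset.range n, Pi.single ⟨s(x (i + 1 + (2 * k : ℕ)), x (i + 1 + (2 * k : ℕ) + 1)), hadj _⟩ 1,
    ?_, ?_, ?_⟩
  · simp only [Finset.sum_apply]
    rw [Finset.sum_comm]
    simp
  · intro e he
    simp only [Finset.sum_apply]
    refine Finset.sum_eq_zero fun k _ => ?_
    rw [Pi.single_eq_of_ne]
    rintro rfl
    apply he
    intro v hv
    simp only [Sym2.mem_iff] at hv
    rcases hv with rfl | rfl <;> simp
  · rw [inc_eq, map_sum]
    simp only [← inc_eq, inc_single]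
    have := sum_pairs (fun l : ℕ => sg ℕ (x (i + 1 + l))) n
    simp only [Nat.cast_add, Nat.cast_one, ← add_assoc] at this
    have h2 := sum_zmod (fun j => sg ℕ (x j)) (i + 1)
    rw [Finset.sum_range_succ] at h2
    have h0 : ((2 * n + 1 : ℕ) : ZMod (2 * n + 1)) = 0 := ZMod.natCast_self _
    have h3 : i + 1 + ((2 * n : ℕ) : ZMod (2 * n + 1)) = i := by
      rw [add_assoc, add_comm 1]; push_cast at h0 ⊢; rw [h0, add_zero]
    rw [h3] at h2
    rw [this, h2]; rfl

lemma sg_cast (v w : V) : ((sg ℕ v w : ℕ) : ℚ) = sg ℚ v w := by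
  classical
  simp [sg, Pi.single_apply]

lemma cC_cast (w : V) : ((cC ℕ n x w : ℕ) : ℚ) = cC ℚ n x w := by
  simp [cC, sg_cast]

lemma even_cast {h : G.edgeSet → ℕ} {v : V} (hh : inc G ℕ h = cC ℕ n x + sg ℕ v) :
    inc G ℚ (fun e => (h e : ℚ)) = cC ℚ n x + sg ℚ v := by
  ext w; rw [inc_cast, hh]; simp [sg_cast, cC_cast]

lemma odd_cast {h : G.edgeSet → ℕ} {v : V} (hh : inc G ℕ h + sg ℕ v = cC ℕ n x) :
    inc G ℚ (fun e => (h e : ℚ)) = cC ℚ n x - sg ℚ v := by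
  ext w; rw [inc_cast, Pi.sub_apply, ← cC_cast, ← hh]; simp [sg_cast]

open Classical in
def Off (G : SimpleGraph V) (x : ZMod (2 * n + 1) → V) (v : V) : Prop :=
  ∃ (ε : ℚ) (q : G.edgeSet → ℚ) (i : ZMod (2 * n + 1)) (y : V) (h : G.Adj (x i) y),
    (ε = 1 ∨ ε = -1) ∧ y ∉ Set.range x ∧ (∀ e, Cyc x e → q e = 0) ∧
    inc G ℚ q = sg ℚ v + ε • sg ℚ (x i) ∧
    ∀ e, Meets x e → (Pi.single ⟨s(x i, y), h⟩ 1 : G.edgeSet → ℚ) e ≤ ε * q e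

lemma mem_or_off (hx : IsUnicyclicOddCycle G n x) (v : V) : v ∈ Set.range x ∨ Off G x v := by
  classical
  have := hx.connected.preconnected (x 0) v
  rw [SimpleGraph.reachable_iff_reflTransGen] at this
  induction this with
  | refl => left; simp
  | @tail u v _ huv ih =>
    by_cases hv : v ∈ Set.range x
    · exact Or.inl hv
    right
    have key : ∀ e, Cyc x e → (Pi.single ⟨s(u, v), huv⟩ 1 : G.edgeSet → ℚ) e = 0 := by
      intro e he
      rw [Pi.single_eq_of_ne]
      rintro rfl
      exact hv (he v (by simp))
    by_cases hu : u ∈ Set.range x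
    · obtain ⟨i, rfl⟩ := hu
      refine ⟨1, Pi.single ⟨s(x i, v), huv⟩ 1, i, v, huv, Or.inl rfl, hv, key, ?_, ?_⟩
      · rw [inc_single, one_smul, add_comm]
      · intro e _; simp
    · obtain ⟨ε, q, i, y, h, hε, hy, hq, hi, hm⟩ := ih.resolve_left hu
      refine ⟨-ε, Pi.single ⟨s(u, v), huv⟩ 1 - q, i, y, h, ?_, hy, ?_, ?_, ?_⟩
      · rcases hε with rfl | rfl <;> simp
      · intro e he; simp [key e he, hq e he]
      · rw [inc_eq, map_sub, ← inc_eq, ← inc_eq, inc_single, hi, neg_smul]; abel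
      · intro e he
        have : (Pi.single ⟨s(u, v), huv⟩ 1 : G.edgeSet → ℚ) e = 0 := by
          rw [Pi.single_eq_of_ne]
          rintro rfl
          obtain ⟨w, hw, hw'⟩ := he
          simp only [Sym2.mem_iff] at hw
          rcases hw with rfl | rfl
          · exact hu hw'
          · exact hv hw'
        have := hm e he
        simp_all

lemma inc_inj (hx : IsUnicyclicOddCycle G n x) : Function.Injective (inc G ℚ) := by
  classical
  have hcard : Fintype.card G.edgeSet = Fintype.card V := by
    rw [← hx.edge_count, Set.ncard_eq_toFinset_card', Set.toFinset_card]
  have hr : ∀ i, sg ℚ (x i) ∈ LinearMap.range (incL G ℚ) := by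
    intro i
    obtain ⟨h, -, -, h1⟩ := exists_even hx i
    obtain ⟨g, -, -, h2⟩ := exists_odd hx i
    have h1 := even_cast h1
    have h2 := odd_cast h2
    refine ⟨(1/2 : ℚ) • ((fun e => (h e : ℚ)) - (fun e => (g e : ℚ))), ?_⟩
    rw [map_smul, map_sub, ← inc_eq, ← inc_eq, h1, h2]
    ext w; simp; ring
  have hsurj : Function.Surjective (incL G ℚ) := by
    rw [← LinearMap.range_eq_top, eq_top_iff]
    intro f _
    have : f = ∑ v, f v • sg ℚ v := by
      ext w; simp [sg, Pi.single_apply]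
    rw [this]
    refine Submodule.sum_mem _ fun v _ => Submodule.smul_mem _ _ ?_
    rcases mem_or_off hx v with ⟨i, rfl⟩ | ⟨ε, q, i, y, h, hε, hy, hq, hi, hm⟩
    · exact hr i
    · have : sg ℚ v = incL G ℚ q - ε • sg ℚ (x i) := by rw [← inc_eq, hi]; abel
      rw [this]
      exact Submodule.sub_mem _ ⟨q, rfl⟩ (Submodule.smul_mem _ _ (hr i))
  exact (LinearMap.injective_iff_surjective_of_finrank_eq_finrank (f := incL G ℚ)
    (by simp [hcard])).2 hsurj

def Tgt (G : SimpleGraph V) (x : ZMod (2 * n + 1) → V) (S : G.edgeSet → Prop)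
    (p : G.edgeSet → ℚ) : Prop :=
  ∃ (w : V) (h : G.edgeSet → ℕ), ∑ e, h e = n + 1 ∧ inc G ℕ h = cC ℕ n x + sg ℕ w ∧
    (∀ e, ¬ S e → h e = 0) ∧ ∀ e, S e → (h e : ℚ) ≤ p e

lemma good (hx : IsUnicyclicOddCycle G n x) (v : V) : ∃ p : G.edgeSet → ℚ,
    inc G ℚ p = cC ℚ n x + sg ℚ v ∧ (∀ e, Cyc x e → 0 ≤ p e) ∧
    (Tgt G x (Cyc x) p ∨ ((∀ e, Meets x e → 0 ≤ p e) ∧ Tgt G x (Meets x) p)) := by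
  classical
  rcases mem_or_off hx v with ⟨i, rfl⟩ | ⟨ε, q, i, y, h, hε, hy, hq, hi, hm⟩
  · obtain ⟨h, hs, h0, h1⟩ := exists_even hx i
    exact ⟨fun e => h e, even_cast h1, fun e _ => by positivity,
      Or.inl ⟨x i, h, hs, h1, h0, fun e _ => le_rfl⟩⟩
  rcases hε with rfl | rfl
  · obtain ⟨g, hs, h0, h1⟩ := exists_odd hx i
    obtain ⟨g', hg'⟩ : ∃ g' : G.edgeSet → ℕ, g' = g + (Pi.single (⟨s(x i, y), h⟩ : G.edgeSet) 1 : G.edgeSet → ℕ) := ⟨_, rfl⟩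
    obtain ⟨p, hpd⟩ : ∃ p : G.edgeSet → ℚ, p = q + fun e => (g e : ℚ) := ⟨_, rfl⟩
    have hp : ∀ e, Meets x e → (g' e : ℚ) ≤ p e := by
      intro e he
      have h3 := hm e he
      have h4 : (((Pi.single ⟨s(x i, y), h⟩ 1 : G.edgeSet → ℕ) e : ℕ) : ℚ) =
          (Pi.single ⟨s(x i, y), h⟩ 1 : G.edgeSet → ℚ) e := by
        by_cases hh : e = ⟨s(x i, y), h⟩
        · rw [hh, Pi.single_eq_same, Pi.single_eq_same, Nat.cast_one]
        · rw [Pi.single_eq_of_ne hh, Pi.single_eq_of_ne hh, Nat.cast_zero]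
      rw [hg', hpd, Pi.add_apply, Pi.add_apply, Nat.cast_add, h4]
      linarith
    refine ⟨p, ?_, ?_, Or.inr ⟨?_, y, g', ?_, ?_, ?_, hp⟩⟩
    · rw [hpd, inc_add, hi, odd_cast h1, one_smul]; abel
    · intro e he; exact le_trans (Nat.cast_nonneg _) (hp e he.meets)
    · intro e he; exact le_trans (Nat.cast_nonneg _) (hp e he)
    · rw [hg']; simp [Finset.sum_add_distrib, hs]
    · rw [hg', inc_add, inc_single, ← h1]; abel
    · intro e he
      have h2 : g e = 0 := h0 e (fun hc => he hc.meets)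
      rw [hg', Pi.add_apply, h2, zero_add, Pi.single_eq_of_ne]
      rintro rfl
      exact he ⟨x i, by simp, by simp⟩
  · obtain ⟨g, hs, h0, h1⟩ := exists_even hx i
    refine ⟨q + fun e => (g e : ℚ), ?_, ?_, Or.inl ⟨x i, g, hs, h1, h0, ?_⟩⟩
    · rw [inc_add, hi, even_cast h1]; simp only [neg_smul, one_smul]; abel
    · intro e he; simp [hq e he]
    · intro e he; simp [hq e he]

lemma core (hx : IsUnicyclicOddCycle G n x) (a b : G.edgeSet → ℕ) (mm : V → ℕ) (t : ℕ)
    (ht : 0 < t) (hmm : ∑ v, mm v = t)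
    (hab : inc G ℕ a = inc G ℕ b + t • cC ℕ n x + mm) :
    ∃ (w : V) (h : G.edgeSet → ℕ), ∑ e, h e = n + 1 ∧ inc G ℕ h = cC ℕ n x + sg ℕ w ∧ h ≤ a := by
  classical
  choose p hp1 hp2 hp3 using good hx
  have ha : (fun e => (a e : ℚ)) = (fun e => (b e : ℚ)) + ∑ v, (mm v : ℚ) • p v := by
    apply inc_inj hx
    rw [inc_add, inc_eq (∑ v, _), map_sum]
    simp only [map_smul, ← inc_eq, hp1]
    ext w
    have := congrFun hab w
    rw [inc_cast, this, Pi.add_apply (inc G ℚ _), inc_cast]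
    simp only [smul_add, Finset.sum_add_distrib, ← Finset.sum_smul]
    have h1 : (∑ v, (mm v : ℚ)) = t := by exact_mod_cast hmm
    rw [h1]
    simp [sg, Pi.single_apply, cC_cast]
    ring
  have fin : ∀ (S : G.edgeSet → Prop) (v : V), 0 < mm v →
      (∀ v', 0 < mm v' → ∀ e, S e → 0 ≤ p v' e) → Tgt G x S (p v) →
      ∃ (w : V) (h : G.edgeSet → ℕ), ∑ e, h e = n + 1 ∧
        inc G ℕ h = cC ℕ n x + sg ℕ w ∧ h ≤ a := by
    rintro S v hv hpos ⟨w, h, hs, hi, h0, hle⟩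
    refine ⟨w, h, hs, hi, fun e => ?_⟩
    by_cases he : S e
    · have h1 := congrFun ha e
      simp only [Pi.add_apply, Finset.sum_apply, Pi.smul_apply, smul_eq_mul] at h1
      have h2 : (mm v : ℚ) * p v e ≤ ∑ v, (mm v : ℚ) * p v e := by
        refine Finset.single_le_sum (f := fun v => (mm v : ℚ) * p v e) ?_ (Finset.mem_univ v)
        intro v' _
        rcases Nat.eq_zero_or_pos (mm v') with h | h
        · simp [h]
        · exact mul_nonneg (by positivity) (hpos v' h e he)
      have h3 : p v e ≤ (mm v : ℚ) * p v e :=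
        le_mul_of_one_le_left (hpos v hv e he) (by exact_mod_cast hv)
      have h4 := hle e he
      have h5 : (0 : ℚ) ≤ b e := by positivity
      have : (h e : ℚ) ≤ a e := by linarith
      exact_mod_cast this
    · rw [h0 e he]; exact Nat.zero_le _
  by_cases hc : ∃ v, 0 < mm v ∧ Tgt G x (Cyc x) (p v)
  · obtain ⟨v, hv, hT⟩ := hc
    exact fin _ v hv (fun v' _ => hp2 v') hT
  · have hc' : ∀ v, 0 < mm v → ((∀ e, Meets x e → 0 ≤ p v e) ∧ Tgt G x (Meets x) (p v)) :=
      fun v hv => (hp3 v).resolve_left fun h => hc ⟨v, hv, h⟩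
    obtain ⟨v, hv⟩ : ∃ v, 0 < mm v := by
      by_contra! hcon
      have : ∑ v, mm v = 0 := Finset.sum_eq_zero fun v _ => Nat.le_zero.1 (hcon v)
      omega
    exact fin _ v hv (fun v' h => (hc' v' h).1) (hc' v hv).2

/-- function to finsupp -/
def fs (g : V → ℕ) : V →₀ ℕ := Finsupp.equivFunOnFinite.symm g

lemma fs_add (g h : V → ℕ) : fs (g + h) = fs g + fs h := by ext; simp [fs]

lemma fs_smul (k : ℕ) (g : V → ℕ) : fs (k • g) = k • fs g := by ext; simp [fs]

lemma fs_sg (v : V) : fs (sg ℕ v) = Finsupp.single v 1 := by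
  classical
  ext w; simp [fs, sg, Pi.single_apply, Finsupp.single_apply, eq_comm]

variable {𝕜 : Type} [Field 𝕜]

def gens (G : SimpleGraph V) (q : ℕ) : Set (V →₀ ℕ) :=
  {m | ∃ a : G.edgeSet → ℕ, ∑ e, a e = q ∧ m = fs (inc G ℕ a)}

def mo (𝕜 : Type) [Field 𝕜] (m : V →₀ ℕ) : MvPolynomial V 𝕜 := monomial m 1

lemma span_mo_mul (S T : Set (V →₀ ℕ)) :
    Ideal.span (mo 𝕜 '' S) * Ideal.span (mo 𝕜 '' T) =
      Ideal.span (mo 𝕜 '' {m | ∃ s ∈ S, ∃ t ∈ T, m = s + t}) := by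
  rw [Ideal.span_mul_span']
  congr 1
  ext f
  simp only [Set.mem_mul, Set.mem_image, Set.mem_ofPred_eq]
  constructor
  · rintro ⟨_, ⟨s, hs, rfl⟩, _, ⟨t, ht, rfl⟩, rfl⟩
    exact ⟨s + t, ⟨s, hs, t, ht, rfl⟩, by simp [mo, monomial_mul]⟩
  · rintro ⟨_, ⟨s, hs, t, ht, rfl⟩, rfl⟩
    exact ⟨_, ⟨s, hs, rfl⟩, _, ⟨t, ht, rfl⟩, by simp [mo, monomial_mul]⟩

lemma edgeIdeal_eq : edgeIdeal 𝕜 G = Ideal.span (mo 𝕜 '' gens G 1) := by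
  classical
  unfold edgeIdeal
  have key : ∀ u v (h : G.Adj u v), (X u * X v : MvPolynomial V 𝕜) =
      mo 𝕜 (fs (inc G ℕ (Pi.single ⟨s(u, v), h⟩ 1))) := by
    intro u v h
    rw [inc_single, fs_add, fs_sg, fs_sg]
    simp [mo, X, monomial_mul]
  congr 1
  ext f
  constructor
  · rintro ⟨u, v, h, rfl⟩
    exact ⟨_, ⟨Pi.single ⟨s(u, v), h⟩ 1, by simp, rfl⟩, (key u v h).symm⟩
  · rintro ⟨_, ⟨a, ha, rfl⟩, rfl⟩
    obtain ⟨e, he⟩ : ∃ e, a = Pi.single e 1 := by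
      obtain ⟨e, he⟩ : ∃ e, 0 < a e := by
        by_contra! hcon
        have : ∑ v, a v = 0 := Finset.sum_eq_zero fun v _ => Nat.le_zero.1 (hcon v)
        omega
      refine ⟨e, ?_⟩
      have h1 := Finset.add_sum_erase Finset.univ a (Finset.mem_univ e)
      have h2 : ∑ e' ∈ Finset.univ.erase e, a e' = 0 := by omega
      rw [Finset.sum_eq_zero_iff] at h2
      ext e'
      by_cases h : e' = e
      · subst h; simp; omega
      · rw [Pi.single_eq_of_ne h]; exact h2 e' (by simp [h])
    obtain ⟨e, hadj⟩ := e
    induction e with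
    | _ u v =>
    subst he
    exact ⟨u, v, hadj, (key u v hadj).symm⟩

lemma edgeIdeal_pow (q : ℕ) : (edgeIdeal 𝕜 G) ^ q = Ideal.span (mo 𝕜 '' gens G q) := by
  classical
  induction q with
  | zero =>
    rw [pow_zero, Ideal.one_eq_top, eq_comm, Ideal.eq_top_iff_one]
    apply Ideal.subset_span
    refine ⟨0, ⟨0, by simp, ?_⟩, ?_⟩
    · ext; simp [fs, inc]
    · simp [mo]
  | succ q ih =>
    rw [pow_succ, ih, edgeIdeal_eq, span_mo_mul]
    congr 2
    ext m
    constructor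
    · rintro ⟨_, ⟨a, ha, rfl⟩, _, ⟨b, hb, rfl⟩, rfl⟩
      exact ⟨a + b, by simp [Finset.sum_add_distrib, ha, hb], by rw [inc_add, fs_add]⟩
    · rintro ⟨a, ha, rfl⟩
      obtain ⟨e, he⟩ : ∃ e, 0 < a e := by
        by_contra! hcon
        have : ∑ v, a v = 0 := Finset.sum_eq_zero fun v _ => Nat.le_zero.1 (hcon v)
        omega
      have hd : a = (a - Pi.single e 1) + Pi.single e 1 := by
        ext e'
        by_cases h : e' = e
        · subst h; simp; omega
        · simp [h]
      have hs : ∑ e', a e' = ∑ e', (a - Pi.single e 1 : G.edgeSet → ℕ) e' + 1 := by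
        conv_lhs => rw [hd]
        simp [Finset.sum_add_distrib]
      refine ⟨_, ⟨a - Pi.single e 1, by omega, rfl⟩, _, ⟨Pi.single e 1, by simp, rfl⟩, ?_⟩
      rw [← fs_add, ← inc_add, ← hd]

lemma prod_eq_mo : (∏ j : ZMod (2 * n + 1), X (x j) : MvPolynomial V 𝕜) = mo 𝕜 (fs (cC ℕ n x)) := by
  have : fs (cC ℕ n x) = ∑ j, Finsupp.single (x j) 1 := by
    simp only [← fs_sg]
    ext; simp [fs, cC]
  rw [this, mo, monomial_sum_one]
  rfl

lemma pow_mul_eq (d t : ℕ) :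
    (edgeIdeal 𝕜 G) ^ d * Ideal.span {mo 𝕜 (fs (cC ℕ n x))} ^ t =
    Ideal.span (mo 𝕜 '' {m | ∃ b : G.edgeSet → ℕ, ∑ e, b e = d ∧
      m = fs (inc G ℕ b + t • cC ℕ n x)}) := by
  have h1 : Ideal.span {mo 𝕜 (fs (cC ℕ n x))} ^ t =
      Ideal.span (mo 𝕜 '' {t • fs (cC ℕ n x)}) := by
    rw [Ideal.span_singleton_pow, Set.image_singleton]
    simp [mo, monomial_pow]
  rw [h1, edgeIdeal_pow, span_mo_mul]
  congr 2
  ext m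
  constructor
  · rintro ⟨_, ⟨b, hb, rfl⟩, _, rfl, rfl⟩
    exact ⟨b, hb, by rw [fs_add, fs_smul]⟩
  · rintro ⟨b, hb, rfl⟩
    exact ⟨_, ⟨b, hb, rfl⟩, _, rfl, by rw [fs_add, fs_smul]⟩

lemma mem_span_mo (m : V →₀ ℕ) (S : Set (V →₀ ℕ)) :
    mo 𝕜 m ∈ Ideal.span (mo 𝕜 '' S) ↔ ∃ s ∈ S, s ≤ m := by
  classical
  have := mem_ideal_span_monomial_image (R := 𝕜) (x := mo 𝕜 m) (s := S)
  refine this.trans ?_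
  simp [mo, support_monomial]

end

/-- with `s = k(n+1) + r`, `0 ≤ r ≤ n`, for every `2 ≤ t ≤ k-1`, every minimal
monomial generator of `I^{s-(n+1)}` lying in `I^{s-(n+1)-t(n+1)}·(c)^t` lies in
`I^{s-2(n+1)}·(c)`. -/
theorem unicyclic_min_gen_descent {V : Type} [Fintype V] (𝕜 : Type) [Field 𝕜]
    (G : SimpleGraph V) (n : ℕ) (hn : 1 ≤ n)
    (x : ZMod (2 * n + 1) → V) (hx : IsUnicyclicOddCycle G n x)
    (c : MvPolynomial V 𝕜) (hc : c = ∏ j : ZMod (2 * n + 1), X (x j))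
    (s k r : ℕ) (hs : s = k * (n + 1) + r) (hr : r ≤ n)
    (t : ℕ) (ht2 : 2 ≤ t) (htk : t ≤ k - 1) :
    ∀ f : MvPolynomial V 𝕜, IsMinMonomialGen ((edgeIdeal 𝕜 G) ^ (s - (n + 1))) f →
      f ∈ (edgeIdeal 𝕜 G) ^ (s - (n + 1) - t * (n + 1)) * (Ideal.span {c}) ^ t →
      f ∈ (edgeIdeal 𝕜 G) ^ (s - 2 * (n + 1)) * Ideal.span {c} := by
  classical
  intro f hf hf2
  subst hc
  rw [prod_eq_mo] at hf2 ⊢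
  rw [← pow_one (Ideal.span {mo 𝕜 (fs (cC ℕ n x))}), pow_mul_eq]
  rw [pow_mul_eq] at hf2
  obtain ⟨⟨m, rfl⟩, hfI, hmin⟩ := hf
  change mo 𝕜 m ∈ _ at hf2 hfI ⊢
  rw [edgeIdeal_pow] at hfI hmin
  have hfI' := hfI
  rw [mem_span_mo] at hfI hf2 ⊢
  obtain ⟨_, ⟨a, ha, rfl⟩, hle⟩ := hfI
  have hm : fs (inc G ℕ a) = m := by
    have := hmin (mo 𝕜 (fs (inc G ℕ a))) ⟨_, rfl⟩ (Ideal.subset_span ⟨_, ⟨a, ha, rfl⟩, rfl⟩)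
      (by simpa [mo] using hle)
    exact monomial_left_injective (one_ne_zero) this
  subst hm
  obtain ⟨_, ⟨b, hb, rfl⟩, hle2⟩ := hf2
  have hle3 : inc G ℕ b + t • cC ℕ n x ≤ inc G ℕ a := fun v => hle2 v
  obtain ⟨mm, hmm⟩ : ∃ mm : V → ℕ, inc G ℕ a = inc G ℕ b + t • cC ℕ n x + mm :=
    ⟨inc G ℕ a - (inc G ℕ b + t • cC ℕ n x), (add_tsub_cancel_of_le hle3).symm⟩
  obtain ⟨k', rfl⟩ : ∃ k', k = k' + t + 1 := ⟨k - 1 - t, by omega⟩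
  have e1 : s - (n + 1) = k' * (n + 1) + t * (n + 1) + r := by
    rw [hs]; apply Nat.sub_eq_of_eq_add; ring
  have e2 : s - (n + 1) - t * (n + 1) = k' * (n + 1) + r := by
    rw [e1]; apply Nat.sub_eq_of_eq_add; ring
  have e3 : s - 2 * (n + 1) = s - (n + 1) - (n + 1) := by omega
  have hsum : ∑ v, mm v = t := by
    have h1 := congrArg (fun g : V → ℕ => ∑ v, g v) hmm
    simp only [Pi.add_apply, Finset.sum_add_distrib, Pi.smul_apply, smul_eq_mul,
      ← Finset.mul_sum, sum_inc, sum_cC] at h1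
    rw [ha, hb, e2, e1] at h1
    push_cast at h1
    nlinarith
  obtain ⟨w, h, hh1, hh2, hh3⟩ := core hx a b mm t (by omega) hsum hmm
  have hd : a = (a - h) + h := (tsub_add_cancel_of_le hh3).symm
  have hs' : ∑ e, a e = ∑ e, (a - h) e + ∑ e, h e := by
    conv_lhs => rw [hd]
    simp only [Pi.add_apply, Finset.sum_add_distrib]
  refine ⟨_, ⟨a - h, by omega, rfl⟩, ?_⟩
  have : inc G ℕ a = inc G ℕ (a - h) + 1 • cC ℕ n x + sg ℕ w := by
    conv_lhs => rw [hd]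
    rw [inc_add, hh2, one_smul, add_assoc]
  rw [this, fs_add (_ + _)]
  exact le_self_add

end
end
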